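/- Fix t ∈ ℝ^d and 1 ≤ i ≤ d. There is a constant K = K(t) < ∞, independent of n and of the cylinder, such that for every n ≥ 1 and every cylinder C = [c₀,…,c_{n−1}] with ν_t(C) > 0: | ∂ log ν_s(C)/∂s_i |_{s=t} − (1/ν_t(C)) ∫_C S_n f̃_i^t dν_t | ≤ K, where f̃_i^t := f_i − ∫ f_i dμ_t. -/

import Mathlib

open MeasureTheory Filter

namespace GibbsPaper

/-- Prepend a symbol to a one-sided sequence. -/
def cons {a : ℕ} (i : Fin a) (x : ℕ → Fin a) : ℕ → Fin a
  | 0 => i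
  | n + 1 => x n

/-- The left shift on sequence space. -/
def shift {a : ℕ} (x : ℕ → Fin a) : ℕ → Fin a := fun n => x (n + 1)

/-- The subshift of finite type determined by the incidence matrix `A`. -/
def SFT {a : ℕ} (A : Fin a → Fin a → Bool) : Set (ℕ → Fin a) :=
  {x | ∀ n, A (x n) (x (n + 1)) = true}

/-- Topological mixing of the subshift, phrased via admissible connecting words. -/
def Mixing {a : ℕ} (A : Fin a → Fin a → Bool) : Prop :=
  ∃ N : ℕ, ∀ n ≥ N, ∀ i j : Fin a, ∃ w : ℕ → Fin a,
    w 0 = i ∧ w n = j ∧ ∀ k < n, A (w k) (w (k + 1)) = true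

/-- Birkhoff sum `S_n h = ∑_{k<n} h ∘ σ^k`. -/
def birkhoff {a : ℕ} (n : ℕ) (h : (ℕ → Fin a) → ℝ) (x : ℕ → Fin a) : ℝ :=
  ∑ k ∈ Finset.range n, h (shift^[k] x)

/-- Hölder continuity with respect to the cylinder (product) structure. -/
def HolderSeq {a : ℕ} (f : (ℕ → Fin a) → ℝ) : Prop :=
  Continuous f ∧ ∃ C ρ : ℝ, 0 < ρ ∧ ρ < 1 ∧
    ∀ n : ℕ, ∀ x y : ℕ → Fin a, (∀ i < n, x i = y i) → |f x - f y| ≤ C * ρ ^ n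

/-- The cylinder `[c₀,…,c_{n-1}]` inside the subshift `Ω = SFT A`. -/
def cyl {a : ℕ} (A : Fin a → Fin a → Bool) (n : ℕ) (c : ℕ → Fin a) : Set (ℕ → Fin a) :=
  {x ∈ SFT A | ∀ i < n, x i = c i}

/-- The Ruelle transfer operator `L_F g (x) = ∑_{σ y = x} e^{F y} g y`. -/
noncomputable def transfer {a : ℕ} (A : Fin a → Fin a → Bool)
    (F g : (ℕ → Fin a) → ℝ) (x : ℕ → Fin a) : ℝ :=
  ∑ i : Fin a, if A i (x 0) = true then Real.exp (F (cons i x)) * g (cons i x) else 0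

/-- `ν` is a probability eigenmeasure of the dual transfer operator `L_F^*` with
eigenvalue `lam`, supported on the subshift. -/
def Eigenmeasure {a : ℕ} (A : Fin a → Fin a → Bool) (F : (ℕ → Fin a) → ℝ)
    (lam : ℝ) (ν : Measure (ℕ → Fin a)) : Prop :=
  IsProbabilityMeasure ν ∧ ν (SFT A)ᶜ = 0 ∧
    ∀ g : (ℕ → Fin a) → ℝ, Continuous g →
      ∫ x, transfer A F g x ∂ν = lam * ∫ x, g x ∂ν

/-- The thermodynamic data on a subshift of finite type: for every Hölder continuous
potential `F`, the pressure `P F`, the Gibbs eigenmeasure `ν F` (the unique probability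
measure with `L_F^* ν = e^{P F} ν`) and the positive Hölder continuous eigenfunction
`φ F` with `L_F (φ F) = e^{P F} φ F`, `∫ φ F dν F = 1`. -/
structure GibbsData (a : ℕ) (A : Fin a → Fin a → Bool) where
  P : ((ℕ → Fin a) → ℝ) → ℝ
  ν : ((ℕ → Fin a) → ℝ) → Measure (ℕ → Fin a)
  φ : ((ℕ → Fin a) → ℝ) → (ℕ → Fin a) → ℝ
  eigen : ∀ F, HolderSeq F → Eigenmeasure A F (Real.exp (P F)) (ν F)
  unique : ∀ F, HolderSeq F → ∀ lam ν', Eigenmeasure A F lam ν' →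
    lam = Real.exp (P F) ∧ ν' = ν F
  φ_holder : ∀ F, HolderSeq F → HolderSeq (φ F)
  φ_pos : ∀ F, HolderSeq F → ∀ x ∈ SFT A, 0 < φ F x
  φ_eigen : ∀ F, HolderSeq F → ∀ x ∈ SFT A,
    transfer A F (φ F) x = Real.exp (P F) * φ F x
  φ_norm : ∀ F, HolderSeq F → ∫ x, φ F x ∂(ν F) = 1

/-- The shift-invariant Gibbs measure `μ_F = φ_F ν_F`. -/
noncomputable def GibbsData.μ {a : ℕ} {A : Fin a → Fin a → Bool} (G : GibbsData a A)
    (F : (ℕ → Fin a) → ℝ) : Measure (ℕ → Fin a) :=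
  (G.ν F).withDensity (fun x => ENNReal.ofReal (G.φ F x))

/-- The linearly parametrized potential `F_t = f₀ + ∑ i, t i • f i`. -/
def Fpot {a d : ℕ} (f₀ : (ℕ → Fin a) → ℝ) (f : Fin d → (ℕ → Fin a) → ℝ)
    (t : Fin d → ℝ) : (ℕ → Fin a) → ℝ :=
  fun x => f₀ x + ∑ i : Fin d, t i * f i x

/-- The vector `F⃗ = (f₀, f₁, …, f_d)`. -/
def Fvec {a d : ℕ} (f₀ : (ℕ → Fin a) → ℝ) (f : Fin d → (ℕ → Fin a) → ℝ) :
    Fin (d + 1) → (ℕ → Fin a) → ℝ :=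
  Fin.cons f₀ f

/-- `Covμ μ f g c` : the asymptotic covariance
`lim (1/m) ∫ S_m(f - ∫ f dμ) S_m(g - ∫ g dμ) dμ` exists and equals `c`. -/
def Covμ {a : ℕ} (μ : Measure (ℕ → Fin a)) (f g : (ℕ → Fin a) → ℝ) (c : ℝ) : Prop :=
  Tendsto (fun m : ℕ => (1 / (m : ℝ)) *
      ∫ x, birkhoff m (fun y => f y - ∫ z, f z ∂μ) x *
        birkhoff m (fun y => g y - ∫ z, g z ∂μ) x ∂μ)
    atTop (nhds c)

/-- `f` and `g` are cohomologous (on the subshift): `g - f = c + h - h∘σ`. -/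
def Cohomologous {a : ℕ} (A : Fin a → Fin a → Bool) (f g : (ℕ → Fin a) → ℝ) : Prop :=
  ∃ c : ℝ, ∃ h : (ℕ → Fin a) → ℝ, Continuous h ∧
    ∀ x ∈ SFT A, g x - f x = c + h x - h (shift x)

/-- `(f₁,…,f_d)` is linearly independent as cohomology classes. -/
def LinIndepCohom {a d : ℕ} (A : Fin a → Fin a → Bool)
    (f : Fin d → (ℕ → Fin a) → ℝ) : Prop :=
  ∀ s : Fin d → ℝ,
    Cohomologous A (fun _ => 0) (fun x => ∑ i : Fin d, s i * f i x) → s = 0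

/-- The supremum of the Birkhoff sum `S_n g` over the cylinder `[c₀,…,c_{n-1}]`. -/
noncomputable def supCyl {a : ℕ} (A : Fin a → Fin a → Bool) (n : ℕ)
    (g : (ℕ → Fin a) → ℝ) (c : ℕ → Fin a) : ℝ :=
  sSup (birkhoff n g '' cyl A n c)

/-- The constraint set `Θ_n^η(x)` of Definition 2.1. -/
noncomputable def ThetaSet {a d : ℕ} (A : Fin a → Fin a → Bool)
    (G : GibbsData a A) (f₀ : (ℕ → Fin a) → ℝ) (f : Fin d → (ℕ → Fin a) → ℝ)
    (Θ : Set (Fin d → ℝ)) (η : ℝ) (n : ℕ) (x : ℕ → Fin a) : Set (Fin d → ℝ) :=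
  {s ∈ Θ | (∀ i : Fin d, |s i| ≤ 1 / η) ∧
    ∀ i : Fin (d + 1),
      |(1 / (n : ℝ)) * supCyl A n (Fvec f₀ f i) x -
        ∫ z, Fvec f₀ f i z ∂(G.μ (Fpot f₀ f s))| ≤ η ^ 2}

/-- `est` is an `η`-maximum likelihood estimator at stage `n` for the data `x`:
it lies in `Θ_n^η(x)` and maximizes `s ↦ ν_s([x₀,…,x_{n-1}])` over `Θ_n^η(x)`. -/
def IsMLE {a d : ℕ} (A : Fin a → Fin a → Bool) (G : GibbsData a A)
    (f₀ : (ℕ → Fin a) → ℝ) (f : Fin d → (ℕ → Fin a) → ℝ) (Θ : Set (Fin d → ℝ))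
    (η : ℝ) (n : ℕ) (x : ℕ → Fin a) (est : Fin d → ℝ) : Prop :=
  est ∈ ThetaSet A G f₀ f Θ η n x ∧
    ∀ s ∈ ThetaSet A G f₀ f Θ η n x,
      G.ν (Fpot f₀ f s) (cyl A n x) ≤ G.ν (Fpot f₀ f est) (cyl A n x)

/-- Weak convergence of a sequence of measures, tested against bounded continuous
functions. -/
def WeakTendsto {E : Type*} [TopologicalSpace E] [MeasurableSpace E]
    (μs : ℕ → Measure E) (μ : Measure E) : Prop :=
  ∀ g : BoundedContinuousFunction E ℝ,
    Tendsto (fun n => ∫ x, g x ∂(μs n)) atTop (nhds (∫ x, g x ∂μ))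

/-- `γ` is the centered `d`-dimensional Gaussian distribution with covariance
matrix `Σ`, characterized through its one-dimensional projections. -/
def IsCenteredGaussian {d : ℕ} (S : Matrix (Fin d) (Fin d) ℝ)
    (γ : Measure (Fin d → ℝ)) : Prop :=
  IsProbabilityMeasure γ ∧
    ∀ l : Fin d → ℝ,
      γ.map (fun x => ∑ i : Fin d, l i * x i) =
        ProbabilityTheory.gaussianReal 0
          (∑ i : Fin d, ∑ j : Fin d, l i * S i j * l j).toNNReal

/-- The random matrix `G(M) = MᵗM − Σ` of Theorem 2.8. -/
noncomputable def Gmat {d : ℕ} (S : Matrix (Fin d) (Fin d) ℝ) (M : Fin d → ℝ) :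
    Matrix (Fin d) (Fin d) ℝ :=
  Matrix.vecMulVec M M - S

/-- The limiting random vector `G⁻¹(N)Nᵗ`. -/
noncomputable def limitVec {d : ℕ} (S : Matrix (Fin d) (Fin d) ℝ) (M : Fin d → ℝ) :
    Fin d → ℝ :=
  (Gmat S M)⁻¹.mulVec M

end GibbsPaper

namespace GibbsPaper

open Asymptotics
open scoped Topology

/-- A bounded, weakly continuous family of functionals applied to a differentiable curve that
vanishes at the base point is differentiable there. -/
theorem hasFDerivAt_apply_of_weaklyContinuous {E : Type*} [NormedAddCommGroup E]
    [NormedSpace ℝ E] {d : ℕ} {t : Fin d → ℝ} {m : (Fin d → ℝ) → E →L[ℝ] ℝ} {K : ℝ}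
    (hK : ∀ s, ‖m s‖ ≤ K) (hcont : ∀ g, Tendsto (fun s => m s g) (𝓝 t) (𝓝 (m t g)))
    {R : (Fin d → ℝ) → E} {R' : (Fin d → ℝ) →L[ℝ] E} (hR : HasFDerivAt R R' t)
    (hRt : R t = 0) :
    HasFDerivAt (fun s => m s (R s)) ((m t).comp R') t := by
  rw [hasFDerivAt_iff_isLittleO]
  have h1 : (fun s => m s (R s - R t - R' (s - t))) =o[𝓝 t] fun s => s - t := by
    refine IsBigO.trans_isLittleO ?_ (hasFDerivAt_iff_isLittleO.1 hR)
    exact IsBigO.of_bound K (Eventually.of_forall fun s => (m s).le_of_opNorm_le (hK s) _)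
  have h2 : (fun s => m s (R' (s - t)) - m t (R' (s - t))) =o[𝓝 t] fun s => s - t := by
    have hexp : ∀ s : Fin d → ℝ, m s (R' (s - t)) - m t (R' (s - t)) =
        ∑ j, (s - t) j * (m s (R' (Pi.single j 1)) - m t (R' (Pi.single j 1))) := by
      intro s
      have hv : R' (s - t) = ∑ j, (s - t) j • R' (Pi.single j 1) := by
        conv_lhs => rw [pi_eq_sum_univ' (s - t)]
        simp only [map_sum, map_smul]
      rw [hv]
      simp only [map_sum, map_smul, smul_eq_mul, ← Finset.sum_sub_distrib, mul_sub]
    simp only [hexp]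
    refine IsLittleO.fun_sum fun j _ => ?_
    have hj : (fun s : Fin d → ℝ => (s - t) j) =O[𝓝 t] fun s => s - t :=
      IsBigO.of_bound 1 (Eventually.of_forall fun s => by
        simpa only [one_mul] using norm_le_pi_norm (s - t) j)
    have ho : (fun s => m s (R' (Pi.single j 1)) - m t (R' (Pi.single j 1)))
        =o[𝓝 t] fun _ => (1 : ℝ) := by
      rw [isLittleO_one_iff]
      simpa using (hcont (R' (Pi.single j 1))).sub_const (m t (R' (Pi.single j 1)))
    have hmul := hj.norm_right.mul_isLittleO ho
    simpa using hmul.norm_right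
  refine (h1.add h2).congr_left fun s => ?_
  simp [hRt]

section Perturbation

variable {X : Type*} [TopologicalSpace X] [CompactSpace X] {d : ℕ}

/-- The multiplicative perturbation `exp (∑ j, (s j - t j) f j)`. -/
noncomputable def expPert (f : Fin d → C(X, ℝ)) (t s : Fin d → ℝ) : C(X, ℝ) :=
  NormedSpace.exp (∑ j, (s j - t j) • f j)

theorem expPert_apply (f : Fin d → C(X, ℝ)) (t s : Fin d → ℝ) (x : X) :
    expPert f t s x = Real.exp (∑ j, (s j - t j) * f j x) := by
  have h := NormedSpace.map_exp (ContinuousMap.evalAlgHom ℝ ℝ x : C(X, ℝ) →ₐ[ℝ] ℝ)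
    (continuous_eval_const x) (∑ j, (s j - t j) • f j)
  rw [← Real.exp_eq_exp_ℝ] at h
  simpa [expPert] using h

theorem expPert_self (f : Fin d → C(X, ℝ)) (t : Fin d → ℝ) : expPert f t t = 1 := by
  simp [expPert]

theorem hasFDerivAt_expPert (f : Fin d → C(X, ℝ)) (t : Fin d → ℝ) :
    HasFDerivAt (expPert f t)
      (∑ j, (ContinuousLinearMap.proj j : (Fin d → ℝ) →L[ℝ] ℝ).smulRight (f j)) t := by
  have hlin : HasFDerivAt (fun s : Fin d → ℝ => ∑ j, (s j - t j) • f j)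
      (∑ j, (ContinuousLinearMap.proj j : (Fin d → ℝ) →L[ℝ] ℝ).smulRight (f j)) t := by
    refine HasFDerivAt.fun_sum fun j _ => ?_
    have h0 : HasFDerivAt (fun s : Fin d → ℝ => s j - t j)
        (ContinuousLinearMap.proj j : (Fin d → ℝ) →L[ℝ] ℝ) t :=
      ((ContinuousLinearMap.proj j : (Fin d → ℝ) →L[ℝ] ℝ).hasFDerivAt).sub_const _
    exact h0.smul_const (f j)
  have hexp : HasFDerivAt (NormedSpace.exp : C(X, ℝ) → C(X, ℝ)) (1 : C(X, ℝ) →L[ℝ] C(X, ℝ))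
      (∑ j, (t j - t j) • f j) := by
    simpa using (hasFDerivAt_exp_zero (𝕂 := ℝ) (𝔸 := C(X, ℝ)))
  exact hexp.comp t hlin

variable {M : C(X, ℝ) →L[ℝ] C(X, ℝ)} {f : Fin d → C(X, ℝ)} {t : Fin d → ℝ}
  {m : (Fin d → ℝ) → C(X, ℝ) →L[ℝ] ℝ} {κ : (Fin d → ℝ) → ℝ} {K c : ℝ}

theorem hasFDerivAt_apply_expPert (M : C(X, ℝ) →L[ℝ] C(X, ℝ)) (f : Fin d → C(X, ℝ))
    (t : Fin d → ℝ) (h : C(X, ℝ)) :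
    HasFDerivAt (fun s => M ((expPert f t s - 1) * h))
      (∑ j, (ContinuousLinearMap.proj j : (Fin d → ℝ) →L[ℝ] ℝ).smulRight (M (f j * h))) t := by
  have h1 := (M.comp ((ContinuousLinearMap.mul ℝ C(X, ℝ)).flip h)).hasFDerivAt.comp t
    ((hasFDerivAt_expPert f t).sub_const 1)
  refine HasFDerivAt.congr_fderiv h1 ?_
  ext v x
  simp [mul_comm h]

theorem apply_sub_eq (heig : ∀ s g, m s (M (expPert f t s * g)) = κ s * m s g)
    (s : Fin d → ℝ) (h : C(X, ℝ)) :
    m s (h - M h) = (1 - κ s) * m s h + m s (M ((expPert f t s - 1) * h)) := by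
  have := heig s h
  rw [sub_mul (expPert f t s), one_mul, map_sub M, map_sub, map_sub, this]
  ring

theorem isBigO_apply_expPert (M : C(X, ℝ) →L[ℝ] C(X, ℝ)) (hK : ∀ s, ‖m s‖ ≤ K) (h : C(X, ℝ)) :
    (fun s => m s (M ((expPert f t s - 1) * h))) =O[𝓝 t] fun s => s - t := by
  have h1 := (hasFDerivAt_apply_expPert M f t h).isBigO_sub
  simp only [expPert_self, sub_self, zero_mul, map_zero, sub_zero] at h1
  exact (IsBigO.of_bound K
    (Eventually.of_forall fun s => (m s).le_of_opNorm_le (hK s) _)).trans h1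

theorem isBigO_eigenvalue_sub_one (hM : M 1 = 1)
    (heig : ∀ s g, m s (M (expPert f t s * g)) = κ s * m s g) (hK : ∀ s, ‖m s‖ ≤ K)
    (hc : 0 < c) (hm : ∀ s, c ≤ m s 1) :
    (fun s => 1 - κ s) =O[𝓝 t] fun s => s - t := by
  refine IsBigO.trans ?_ (isBigO_apply_expPert (f := f) M hK 1)
  refine IsBigO.of_bound (1 / c) (Eventually.of_forall fun s => ?_)
  have h := apply_sub_eq heig s 1
  rw [hM, sub_self, map_zero] at h
  have h' : m s (M ((expPert f t s - 1) * 1)) = -((1 - κ s) * m s 1) := by linarith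
  rw [h', norm_neg, norm_mul, Real.norm_of_nonneg (hc.le.trans (hm s)), one_div,
    ← div_eq_inv_mul, le_div_iff₀ hc]
  gcongr
  exact hm s

theorem tendsto_apply_of_dense (hM : M 1 = 1)
    (heig : ∀ s g, m s (M (expPert f t s * g)) = κ s * m s g) (hK : ∀ s, ‖m s‖ ≤ K)
    (hc : 0 < c) (hm : ∀ s, c ≤ m s 1) {ψ : C(X, ℝ)} (hψ : ∀ s, m s ψ = 1)
    (hdense : Dense {g : C(X, ℝ) | ∃ h, ∃ r : ℝ, g = h - M h + r • ψ}) (g : C(X, ℝ)) :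
    Tendsto (fun s => m s g) (𝓝 t) (𝓝 (m t g)) := by
  have hK0 : 0 ≤ K := (norm_nonneg (m t)).trans (hK t)
  have hsub : Tendsto (fun s : Fin d → ℝ => s - t) (𝓝 t) (𝓝 0) := by
    simpa using (tendsto_id (α := Fin d → ℝ) (x := 𝓝 t)).sub_const t
  have hsolv : ∀ h : C(X, ℝ), Tendsto (fun s => m s (h - M h)) (𝓝 t) (𝓝 0) := by
    intro h
    have h1 : (fun s => (1 - κ s) * m s h) =O[𝓝 t] fun s => s - t := by
      have hb : (fun s => m s h) =O[𝓝 t] fun _ => (1 : ℝ) :=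
        IsBigO.of_bound (K * ‖h‖) (Eventually.of_forall fun s => by
          simpa using (m s).le_of_opNorm_le (hK s) h)
      simpa using ((isBigO_eigenvalue_sub_one hM heig hK hc hm).norm_right.mul hb).norm_right
    have h2 := h1.add (isBigO_apply_expPert (f := f) M hK h)
    simp only [← apply_sub_eq heig] at h2
    exact h2.trans_tendsto hsub
  rw [Metric.tendsto_nhds]
  intro ε hε
  obtain ⟨g', ⟨h, r, rfl⟩, hg'⟩ := hdense.exists_dist_lt g
    (show 0 < ε / (4 * (K + 1)) by positivity)
  have hev := (Metric.tendsto_nhds.1 (hsolv h)) (ε / 4) (by positivity)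
  have hevt := hev.self_of_nhds
  filter_upwards [hev] with s hs
  have hb : ∀ s, |m s (g - (h - M h + r • ψ))| ≤ ε / 4 := by
    intro s
    refine ((m s).le_of_opNorm_le (hK s) _).trans ?_
    rw [dist_eq_norm] at hg'
    calc K * ‖g - (h - M h + r • ψ)‖ ≤ (K + 1) * (ε / (4 * (K + 1))) := by gcongr; linarith
      _ = ε / 4 := by field_simp
  have e : ∀ s, m s g = m s (g - (h - M h + r • ψ)) + m s (h - M h) + r := by
    intro s
    rw [map_sub (m s) g, map_add, map_smul, hψ s, smul_eq_mul]
    ring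
  rw [Real.dist_eq, e s, e t]
  rw [Real.dist_eq, sub_zero] at hs hevt
  have a1 := abs_le.1 (hb s)
  have a2 := abs_le.1 (hb t)
  have a3 := abs_lt.1 hs
  have a4 := abs_lt.1 hevt
  rw [abs_lt]
  constructor <;> linarith

/-- Linear response: derivative of the eigenfunctionals on functions of the form `h - M h`. -/
theorem hasFDerivAt_apply_sub (hM : M 1 = 1)
    (heig : ∀ s g, m s (M (expPert f t s * g)) = κ s * m s g) (hK : ∀ s, ‖m s‖ ≤ K)
    (hc : 0 < c) (hm : ∀ s, c ≤ m s 1) {ψ : C(X, ℝ)} (hψ : ∀ s, m s ψ = 1)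
    (hdense : Dense {g : C(X, ℝ) | ∃ h, ∃ r : ℝ, g = h - M h + r • ψ})
    (hmt : m t 1 = 1) (hinv : ∀ g, m t (M g) = m t g) (h : C(X, ℝ)) :
    HasFDerivAt (fun s => m s (h - M h))
      (∑ j, m t ((f j - m t (f j) • 1) * h) •
        (ContinuousLinearMap.proj j : (Fin d → ℝ) →L[ℝ] ℝ)) t := by
  have hcont := tendsto_apply_of_dense hM heig hK hc hm hψ hdense
  set h' : C(X, ℝ) := h - m t h • 1 with hh'
  have hzero : m t h' = 0 := by simp [hh', hmt]
  have hfun : (fun s => m s (h - M h)) =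
      fun s => (1 - κ s) * m s h' + m s (M ((expPert f t s - 1) * h')) := by
    funext s
    rw [← apply_sub_eq heig s h']
    congr 1
    simp [hh', hM]
  rw [hfun]
  have h1 : HasFDerivAt (fun s => (1 - κ s) * m s h') (0 : (Fin d → ℝ) →L[ℝ] ℝ) t := by
    rw [hasFDerivAt_iff_isLittleO]
    have ho : (fun s => m s h') =o[𝓝 t] fun _ => (1 : ℝ) := by
      rw [isLittleO_one_iff, ← hzero]
      exact hcont h'
    have := ((isBigO_eigenvalue_sub_one hM heig hK hc hm).norm_right.mul_isLittleO ho)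
    simpa [hzero] using this.norm_right
  have h2 := hasFDerivAt_apply_of_weaklyContinuous hK hcont
    (hasFDerivAt_apply_expPert M f t h') (by simp [expPert_self])
  refine HasFDerivAt.congr_fderiv (h1.add h2) ?_
  refine ContinuousLinearMap.ext fun v => ?_
  simp only [sum_apply, smul_apply,
    ContinuousLinearMap.proj_apply, zero_add, ContinuousLinearMap.comp_apply,
    ContinuousLinearMap.smulRight_apply, map_sum, map_smul, hinv, smul_eq_mul]
  refine Finset.sum_congr rfl fun j _ => ?_
  have : m t (f j * h') = m t ((f j - m t (f j) • 1) * h) := by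
    rw [hh', mul_sub, sub_mul, map_sub, map_sub, mul_smul_comm, smul_mul_assoc, map_smul,
      map_smul, mul_one, one_mul, smul_eq_mul, smul_eq_mul, mul_comm (m t h)]
  rw [this, mul_comm]

end Perturbation

section Symbolic

variable {a : ℕ} {A : Fin a → Fin a → Bool}

/-- Two points of the subshift share their first `n` symbols. -/
def Agree (n : ℕ) (x y : SFT A) : Prop := ∀ k < n, x.1 k = y.1 k

theorem Agree.symm {n : ℕ} {x y : SFT A} (h : Agree n x y) : Agree n y x :=
  fun k hk => (h k hk).symm

theorem Agree.mono {m n : ℕ} (hmn : m ≤ n) {x y : SFT A} (h : Agree n x y) : Agree m x y :=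
  fun k hk => h k (hk.trans_le hmn)

theorem isClosed_SFT : IsClosed (SFT A) := by
  have : SFT A = ⋂ n, {x : ℕ → Fin a | A (x n) (x (n + 1)) = true} := by
    ext x; simp [SFT]
  rw [this]
  refine isClosed_iInter fun n => ?_
  have hc : Continuous fun x : ℕ → Fin a => A (x n) (x (n + 1)) :=
    (continuous_of_discreteTopology (f := fun q : Fin a × Fin a => A q.1 q.2)).comp
      (g := fun q : Fin a × Fin a => A q.1 q.2) (f := fun x : ℕ → Fin a => (x n, x (n + 1)))
      ((continuous_apply n).prodMk (continuous_apply (n + 1)))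
  exact (isClosed_discrete {true}).preimage hc

instance : CompactSpace (SFT A) := isCompact_iff_compactSpace.1 isClosed_SFT.isCompact

/-- The shift on the subshift. -/
def shiftX : C(SFT A, SFT A) where
  toFun x := ⟨shift x.1, fun n => x.2 (n + 1)⟩
  continuous_toFun := by
    refine Continuous.subtype_mk (continuous_pi fun k => ?_) _
    exact (continuous_apply (k + 1)).comp continuous_subtype_val

theorem shiftX_val (x : SFT A) : (shiftX x).1 = shift x.1 := rfl

theorem iterate_shift (k n : ℕ) (x : ℕ → Fin a) : shift^[k] x n = x (n + k) := by
  induction k generalizing n with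
  | zero => rfl
  | succ k ih =>
    rw [Function.iterate_succ_apply']
    exact (ih (n + 1)).trans (congrArg x (by ring))

theorem iterate_shiftX_val (k : ℕ) (x : SFT A) : (shiftX^[k] x).1 = shift^[k] x.1 := by
  induction k with
  | zero => rfl
  | succ k ih => rw [Function.iterate_succ_apply', Function.iterate_succ_apply', ← ih]; rfl

variable [Nonempty (SFT A)]

open Classical in
/-- The inverse branch of the shift prepending the symbol `i`; it takes a constant value where
prepending `i` is not admissible. -/
noncomputable def branch (i : Fin a) : C(SFT A, SFT A) where
  toFun x := if h : A i (x.1 0) = true then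
      ⟨cons i x.1, fun n => by cases n with
        | zero => exact h
        | succ n => exact x.2 n⟩
    else Classical.arbitrary _
  continuous_toFun := by
    refine continuous_induced_rng.2 (continuous_pi fun k => ?_)
    have hc : Continuous fun x : SFT A => (x.1 0, cons i x.1 k) := by
      refine ((continuous_apply 0).comp continuous_subtype_val).prodMk ?_
      cases k with
      | zero => exact continuous_const
      | succ k => exact (continuous_apply k).comp continuous_subtype_val
    refine ((continuous_of_discreteTopology (f := fun q : Fin a × Fin a =>
      if A i q.1 = true then q.2 else (Classical.arbitrary (SFT A)).1 k)).comp hc).congr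
        fun x => ?_
    by_cases h : A i (x.1 0) = true <;> simp [h]

theorem branch_val {i : Fin a} {x : SFT A} (h : A i (x.1 0) = true) :
    (branch i x).1 = cons i x.1 := by
  simp [branch, h]

theorem shiftX_branch {i : Fin a} {x : SFT A} (h : A i (x.1 0) = true) :
    shiftX (branch i x) = x := by
  apply Subtype.ext
  rw [shiftX_val, branch_val h]
  rfl

theorem branch_shiftX (x : SFT A) : branch (x.1 0) (shiftX x) = x := by
  apply Subtype.ext
  rw [branch_val (x.2 0)]
  funext k
  cases k <;> rfl

theorem Agree.branch {n : ℕ} {x y : SFT A} (hxy : Agree (n + 1) x y) (i : Fin a) :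
    Agree (n + 2) (branch i x) (branch i y) := by
  by_cases h : A i (x.1 0) = true
  · intro k hk
    rw [branch_val h, branch_val (hxy 0 n.succ_pos ▸ h)]
    cases k with
    | zero => rfl
    | succ k => exact hxy k (by omega)
  · have h' : ¬ A i (y.1 0) = true := hxy 0 n.succ_pos ▸ h
    intro k _
    simp [GibbsPaper.branch, h, h']

/-- The indicator of `{x | A i (x 0)}`. -/
def admissible (A : Fin a → Fin a → Bool) (i : Fin a) : C(SFT A, ℝ) where
  toFun x := if A i (x.1 0) = true then 1 else 0
  continuous_toFun := (continuous_of_discreteTopology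
    (f := fun j : Fin a => if A i j = true then (1 : ℝ) else 0)).comp
      ((continuous_apply 0).comp continuous_subtype_val)

omit [Nonempty (SFT A)] in
theorem admissible_apply (i : Fin a) (x : SFT A) :
    admissible A i x = if A i (x.1 0) = true then 1 else 0 := rfl

/-- The operator `g ↦ (x ↦ ∑_{σ y = x} g y)`. -/
noncomputable def sumPre (A : Fin a → Fin a → Bool) [Nonempty (SFT A)] :
    C(SFT A, ℝ) →L[ℝ] C(SFT A, ℝ) :=
  ∑ i, (ContinuousLinearMap.mul ℝ C(SFT A, ℝ) (admissible A i)).comp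
    ⟨(ContinuousMap.compRightAlgHom ℝ ℝ (branch i)).toLinearMap,
      ContinuousMap.compRightAlgHom_continuous ℝ ℝ (branch i)⟩

theorem sumPre_apply (g : C(SFT A, ℝ)) (x : SFT A) :
    sumPre A g x = ∑ i, if A i (x.1 0) = true then g (branch i x) else 0 := by
  simp only [sumPre, sum_apply, ContinuousMap.sum_apply, ContinuousLinearMap.comp_apply,
    ContinuousLinearMap.mul_apply', ContinuousMap.mul_apply, admissible_apply, ite_mul, one_mul,
    zero_mul]
  rfl

theorem sumPre_nonneg {g : C(SFT A, ℝ)} (hg : 0 ≤ g) : 0 ≤ sumPre A g := by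
  intro x
  change 0 ≤ sumPre A g x
  rw [sumPre_apply]
  refine Finset.sum_nonneg fun i _ => ?_
  split_ifs
  · exact hg _
  · exact le_rfl

theorem sumPre_comp_shiftX_mul (b g : C(SFT A, ℝ)) :
    sumPre A (b.comp shiftX * g) = b * sumPre A g := by
  ext x
  rw [ContinuousMap.mul_apply, sumPre_apply, sumPre_apply, Finset.mul_sum]
  refine Finset.sum_congr rfl fun i _ => ?_
  split_ifs with h
  · simp [shiftX_branch h]
  · simp

/-- The Ruelle operator `g ↦ (x ↦ ∑_{σ y = x} p y * g y)` with weight `p`. -/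
noncomputable def ruelle (p : C(SFT A, ℝ)) : C(SFT A, ℝ) →L[ℝ] C(SFT A, ℝ) :=
  (sumPre A).comp (ContinuousLinearMap.mul ℝ _ p)

theorem ruelle_eq (p g : C(SFT A, ℝ)) : ruelle p g = sumPre A (p * g) := rfl

theorem ruelle_apply (p g : C(SFT A, ℝ)) (x : SFT A) : ruelle p g x =
    ∑ i, if A i (x.1 0) = true then p (branch i x) * g (branch i x) else 0 := by
  rw [ruelle_eq, sumPre_apply]
  rfl

theorem ruelle_comp_shiftX_mul (p b g : C(SFT A, ℝ)) :
    ruelle p (b.comp shiftX * g) = b * ruelle p g := by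
  rw [ruelle_eq, mul_left_comm, sumPre_comp_shiftX_mul, ruelle_eq]

/-- A positive weight with total mass one over each fibre of the shift, whose logarithm is
Hölder continuous. -/
structure NormalizedWeight (p : C(SFT A, ℝ)) (ρ B : ℝ) : Prop where
  rho_pos : 0 < ρ
  rho_lt_one : ρ < 1
  B_nonneg : 0 ≤ B
  pos : ∀ x, 0 < p x
  normalized : sumPre A p = 1
  distortion : ∀ n x y, Agree (n + 1) x y → p x ≤ Real.exp (B * ρ ^ n) * p y

variable {p : C(SFT A, ℝ)} {ρ B : ℝ}

namespace NormalizedWeight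

theorem ruelle_one (hp : NormalizedWeight p ρ B) : ruelle p 1 = 1 := by
  rw [ruelle_eq, mul_one, hp.normalized]

theorem ruelle_nonneg (hp : NormalizedWeight p ρ B) {g : C(SFT A, ℝ)} (hg : 0 ≤ g) :
    0 ≤ ruelle p g :=
  sumPre_nonneg (mul_nonneg (fun x => (hp.pos x).le) hg)

theorem ruelle_mono (hp : NormalizedWeight p ρ B) {g h : C(SFT A, ℝ)} (hgh : g ≤ h) :
    ruelle p g ≤ ruelle p h := by
  have := hp.ruelle_nonneg (sub_nonneg.2 hgh)
  rwa [map_sub, sub_nonneg] at this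

theorem iterate_nonneg (hp : NormalizedWeight p ρ B) (k : ℕ) {g : C(SFT A, ℝ)} (hg : 0 ≤ g) :
    0 ≤ (ruelle p)^[k] g := by
  induction k with
  | zero => exact hg
  | succ k ih => rw [Function.iterate_succ_apply']; exact hp.ruelle_nonneg ih

theorem iterate_smul_one (hp : NormalizedWeight p ρ B) (k : ℕ) (r : ℝ) :
    (ruelle p)^[k] (r • 1) = r • 1 := by
  induction k with
  | zero => rfl
  | succ k ih => rw [Function.iterate_succ_apply', ih, map_smul, hp.ruelle_one]

theorem iterate_sub (k : ℕ) (g h : C(SFT A, ℝ)) :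
    (ruelle p)^[k] (g - h) = (ruelle p)^[k] g - (ruelle p)^[k] h := by
  induction k with
  | zero => rfl
  | succ k ih => simp only [Function.iterate_succ_apply', ih, map_sub]

theorem sum_weight_eq_one (hp : NormalizedWeight p ρ B) (x : SFT A) :
    ∑ i, (if A i (x.1 0) = true then p (branch i x) else 0) = 1 := by
  rw [← sumPre_apply, hp.normalized]; rfl

theorem norm_ruelle_le (hp : NormalizedWeight p ρ B) (g : C(SFT A, ℝ)) : ‖ruelle p g‖ ≤ ‖g‖ := by
  rw [ContinuousMap.norm_le _ (norm_nonneg g)]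
  intro x
  have h1 : g ≤ ‖g‖ • (1 : C(SFT A, ℝ)) := fun y => by
    simpa using (le_abs_self _).trans (g.norm_coe_le_norm y)
  have h2 : -(‖g‖ • (1 : C(SFT A, ℝ))) ≤ g := fun y => by
    simpa using (abs_le.1 (g.norm_coe_le_norm y)).1
  have h3 := hp.ruelle_mono h1 x
  have h4 := hp.ruelle_mono h2 x
  rw [map_neg, map_smul, hp.ruelle_one] at h4
  rw [map_smul, hp.ruelle_one] at h3
  rw [Real.norm_eq_abs, abs_le]
  constructor
  · simpa using h4
  · simpa using h3

theorem exists_lower_bound (hp : NormalizedWeight p ρ B) :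
    ∃ δ, 0 < δ ∧ δ ≤ 1 ∧ ∀ k (g : C(SFT A, ℝ)), 0 ≤ g → ∀ w,
      δ ^ k * g w ≤ (ruelle p)^[k] g (shiftX^[k] w) := by
  obtain ⟨w₀, -, hw₀⟩ := isCompact_univ.exists_isMinOn (s := (Set.univ : Set (SFT A)))
    Set.univ_nonempty p.continuous.continuousOn
  have hstep : ∀ g : C(SFT A, ℝ), 0 ≤ g → ∀ w, p w₀ * g w ≤ ruelle p g (shiftX w) := by
    intro g hg w
    rw [ruelle_apply]
    calc p w₀ * g w ≤ p w * g w :=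
          mul_le_mul_of_nonneg_right (hw₀ (Set.mem_univ w)) (hg w)
      _ = if A (w.1 0) ((shiftX w).1 0) = true then
            p (branch (w.1 0) (shiftX w)) * g (branch (w.1 0) (shiftX w)) else 0 := by
          rw [branch_shiftX, if_pos]
          exact w.2 0
      _ ≤ _ := Finset.single_le_sum (f := fun i => if A i ((shiftX w).1 0) = true then
            p (branch i (shiftX w)) * g (branch i (shiftX w)) else 0) (fun i _ => by
          split_ifs
          · exact mul_nonneg (hp.pos _).le (hg _)
          · exact le_rfl) (Finset.mem_univ _)
  refine ⟨p w₀, hp.pos w₀, ?_, ?_⟩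
  · simpa [hp.ruelle_one] using hstep 1 (fun _ => zero_le_one) w₀
  · intro k g hg w
    induction k with
    | zero => simp
    | succ k ih =>
      rw [Function.iterate_succ_apply', Function.iterate_succ_apply', pow_succ']
      refine le_trans ?_ (hstep _ (hp.iterate_nonneg k hg) _)
      rw [mul_assoc]
      exact mul_le_mul_of_nonneg_left ih (hp.pos w₀).le

end NormalizedWeight

omit [Nonempty (SFT A)] in
/-- In a mixing subshift any initial word can be joined to any point, with connecting words of
a fixed length. -/
theorem Mixing.exists_connecting (hmix : Mixing A) :
    ∃ N, ∀ (m : ℕ) (z y : SFT A), ∃ w : SFT A, Agree m w z ∧ shiftX^[m + N] w = y := by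
  obtain ⟨N, hN⟩ := hmix
  refine ⟨N, fun m z y => ?_⟩
  obtain ⟨v, hv0, hvN, hv⟩ := hN N le_rfl (z.1 m) (y.1 0)
  refine ⟨⟨fun k => if k < m then z.1 k else if k ≤ m + N then v (k - m) else y.1 (k - m - N),
    fun k => ?_⟩, fun k hk => if_pos hk, ?_⟩
  · rcases lt_trichotomy (k + 1) m with h | h | h
    · simp only [h, (Nat.lt_succ_self k).trans h, if_true]
      exact z.2 k
    · have h1 : k < m := by omega
      simp only [h, h1, if_true, lt_irrefl, if_false, Nat.le_add_right, Nat.sub_self, hv0]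
      exact h ▸ z.2 k
    · have h1 : ¬ k < m := by omega
      have h2 : ¬ k + 1 < m := by omega
      simp only [h1, h2, if_false]
      rcases lt_trichotomy k (m + N) with h3 | h3 | h3
      · rw [if_pos h3.le, if_pos (Nat.succ_le_of_lt h3), Nat.sub_add_comm (not_lt.1 h1)]
        exact hv _ (by omega)
      · rw [if_pos h3.le, if_neg (by omega), show k - m = N by omega, hvN,
          show k + 1 - m - N = 0 + 1 by omega]
        exact y.2 0
      · rw [if_neg (by omega), if_neg (by omega),
          show k + 1 - m - N = (k - m - N) + 1 by omega]
        exact y.2 _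
  · apply Subtype.ext
    rw [iterate_shiftX_val]
    funext k
    rw [iterate_shift]
    dsimp only
    rw [if_neg (by omega)]
    by_cases hk : k = 0
    · subst hk
      rw [if_pos (by omega), show 0 + (m + N) - m = N by omega, hvN]
    · rw [if_neg (by omega)]
      rw [show k + (m + N) - m - N = k by omega]

end Symbolic

theorem abs_sub_le_of_le_exp_mul {u v E D : ℝ} (hE : 0 ≤ E) (hED : E ≤ D) (hv : 0 ≤ v)
    (huv : u ≤ Real.exp E * v) (hvu : v ≤ Real.exp E * u) :
    |u - v| ≤ Real.exp D * E * v := by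
  have h1 : Real.exp E * (1 - E) ≤ 1 := by
    calc Real.exp E * (1 - E) ≤ Real.exp E * Real.exp (-E) := by
          gcongr
          linarith [Real.add_one_le_exp (-E)]
      _ = 1 := by rw [← Real.exp_add, add_neg_cancel, Real.exp_zero]
  have h2 : Real.exp E ≤ Real.exp D := Real.exp_le_exp.2 hED
  have h3 : Real.exp E * E * v ≤ Real.exp D * E * v := by gcongr
  have h4 : 0 ≤ Real.exp E := (Real.exp_pos E).le
  have h5 : 1 ≤ Real.exp E := Real.one_le_exp hE
  rw [abs_le]
  constructor
  · have h6 : Real.exp E * (v - u) ≤ Real.exp E * (E * v) := by nlinarith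
    have h7 := le_of_mul_le_mul_left h6 (Real.exp_pos E)
    nlinarith [mul_nonneg hE hv]
  · nlinarith

section Symbolic

variable {a : ℕ} {A : Fin a → Fin a → Bool}

/-- The function `g` has oscillation at most `O`, and Hölder constant at most `V` on cylinders of
positive length. -/
def OscHol (ρ : ℝ) (g : C(SFT A, ℝ)) (O V : ℝ) : Prop :=
  (∀ x y, |g x - g y| ≤ O) ∧ ∀ n x y, Agree (n + 1) x y → |g x - g y| ≤ V * ρ ^ (n + 1)

theorem OscHol.mono {ρ : ℝ} (hρ : 0 ≤ ρ) {g : C(SFT A, ℝ)} {O V O' V' : ℝ}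
    (h : OscHol ρ g O V) (hO : O ≤ O') (hV : V ≤ V') : OscHol ρ g O' V' :=
  ⟨fun x y => (h.1 x y).trans hO, fun n x y hxy => (h.2 n x y hxy).trans (by gcongr)⟩

variable [Nonempty (SFT A)] {p : C(SFT A, ℝ)} {ρ B : ℝ}

theorem OscHol.nonneg {g : C(SFT A, ℝ)} {O V : ℝ} (h : OscHol ρ g O V) : 0 ≤ O :=
  (abs_nonneg _).trans (h.1 (Classical.arbitrary _) (Classical.arbitrary _))

namespace NormalizedWeight

theorem osc_ruelle_le (hp : NormalizedWeight p ρ B) {g : C(SFT A, ℝ)} {O : ℝ}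
    (hg : ∀ x y, |g x - g y| ≤ O) (x y : SFT A) : |ruelle p g x - ruelle p g y| ≤ O := by
  have key : ∀ x y, ruelle p g x ≤ ruelle p g y + O := by
    intro x y
    have h1 : ∀ z, ruelle p g x ≤ g z + O := by
      intro z
      have h : g ≤ (g z + O) • (1 : C(SFT A, ℝ)) := fun w => by
        simpa using by linarith [(abs_le.1 (hg w z)).2]
      simpa [map_smul, hp.ruelle_one] using hp.ruelle_mono h x
    have h2 : (ruelle p g x - O) • (1 : C(SFT A, ℝ)) ≤ g := fun z => by
      simpa using h1 z
    have h3 : ruelle p g x - O ≤ ruelle p g y := by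
      simpa [map_smul, hp.ruelle_one] using hp.ruelle_mono h2 y
    linarith
  rw [abs_le]
  constructor <;> linarith [key x y, key y x]

theorem oscHol_ruelle (hp : NormalizedWeight p ρ B) {g : C(SFT A, ℝ)} {O V : ℝ}
    (hg : OscHol ρ g O V) :
    OscHol ρ (ruelle p g) O (ρ * V + Real.exp B * B * O) := by
  refine ⟨hp.osc_ruelle_le hg.1, fun n x y hxy => ?_⟩
  set c := g x
  have hc : ∀ z, ruelle p g z - c =
      ∑ i, if A i (z.1 0) = true then p (branch i z) * (g (branch i z) - c) else 0 := by
    intro z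
    conv_lhs => rw [← one_mul c, ← hp.sum_weight_eq_one z, Finset.sum_mul, ruelle_apply,
      ← Finset.sum_sub_distrib]
    refine Finset.sum_congr rfl fun i _ => ?_
    split_ifs <;> ring
  have hx0 : x.1 0 = y.1 0 := hxy 0 n.succ_pos
  have hdiff : ruelle p g x - ruelle p g y = ∑ i, if A i (y.1 0) = true then
      p (branch i x) * (g (branch i x) - c) - p (branch i y) * (g (branch i y) - c) else 0 := by
    rw [← sub_sub_sub_cancel_right _ _ c, hc x, hc y, ← Finset.sum_sub_distrib, hx0]
    refine Finset.sum_congr rfl fun i _ => ?_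
    split_ifs <;> ring
  rw [hdiff]
  calc |∑ i, if A i (y.1 0) = true then
        p (branch i x) * (g (branch i x) - c) - p (branch i y) * (g (branch i y) - c) else 0|
      ≤ ∑ i, |if A i (y.1 0) = true then
        p (branch i x) * (g (branch i x) - c) - p (branch i y) * (g (branch i y) - c) else 0| :=
        Finset.abs_sum_le_sum_abs _ _
    _ ≤ ∑ i, (if A i (y.1 0) = true then p (branch i y) else 0) *
        ((ρ * V + Real.exp B * B * O) * ρ ^ (n + 1)) := by
        refine Finset.sum_le_sum fun i _ => ?_
        split_ifs
        swap
        · simp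
        have hb := hxy.branch i
        have h1 := hg.2 (n + 1) _ _ hb
        have hE : B * ρ ^ (n + 1) ≤ B :=
          mul_le_of_le_one_right hp.B_nonneg (pow_le_one₀ hp.rho_pos.le hp.rho_lt_one.le)
        have h2 := abs_sub_le_of_le_exp_mul (mul_nonneg hp.B_nonneg (pow_nonneg hp.rho_pos.le _))
          hE (hp.pos (branch i y)).le (hp.distortion _ _ _ hb) (hp.distortion _ _ _ hb.symm)
        have h3 := hg.1 (branch i x) x
        have hpy := (hp.pos (branch i y)).le
        have hρ := hp.rho_pos
        have hB := hp.B_nonneg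
        calc |p (branch i x) * (g (branch i x) - c) - p (branch i y) * (g (branch i y) - c)|
            = |p (branch i y) * (g (branch i x) - g (branch i y)) +
              (p (branch i x) - p (branch i y)) * (g (branch i x) - c)| := by congr 1; ring
          _ ≤ p (branch i y) * |g (branch i x) - g (branch i y)| +
              |p (branch i x) - p (branch i y)| * |g (branch i x) - c| := by
              refine (abs_add_le _ _).trans ?_
              rw [abs_mul, abs_mul, abs_of_nonneg hpy]
          _ ≤ p (branch i y) * (V * ρ ^ (n + 1 + 1)) +
              (Real.exp B * (B * ρ ^ (n + 1)) * p (branch i y)) * O := by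
              gcongr
          _ = _ := by ring
    _ = _ := by rw [← Finset.sum_mul, hp.sum_weight_eq_one, one_mul]

theorem oscHol_iterate (hp : NormalizedWeight p ρ B) {g : C(SFT A, ℝ)} {O V : ℝ}
    (hg : OscHol ρ g O V) (j : ℕ) :
    OscHol ρ ((ruelle p)^[j] g) O (ρ ^ j * V + Real.exp B * B / (1 - ρ) * O) := by
  have h1 : 0 < 1 - ρ := sub_pos.2 hp.rho_lt_one
  have hO := hg.nonneg
  have hB := hp.B_nonneg
  induction j with
  | zero => exact hg.mono hp.rho_pos.le le_rfl (by
      rw [pow_zero, one_mul, le_add_iff_nonneg_right]; positivity)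
  | succ j ih =>
    rw [Function.iterate_succ_apply']
    refine (hp.oscHol_ruelle ih).mono hp.rho_pos.le le_rfl (le_of_eq ?_)
    field_simp
    ring

theorem osc_iterate_le (hp : NormalizedWeight p ρ B) (hmix : Mixing A) :
    ∃ N₀ δ, 0 < δ ∧ δ ≤ 1 ∧ ∀ m (g : C(SFT A, ℝ)) (O V : ℝ), OscHol ρ g O V → ∀ x y,
      |(ruelle p)^[m + 1 + N₀] g x - (ruelle p)^[m + 1 + N₀] g y| ≤
        (1 - δ ^ (m + 1 + N₀)) * O + δ ^ (m + 1 + N₀) * (V * ρ ^ (m + 1)) := by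
  obtain ⟨N₀, hN⟩ := hmix.exists_connecting
  obtain ⟨δ, hδ, hδ1, hlow⟩ := hp.exists_lower_bound
  refine ⟨N₀, δ, hδ, hδ1, fun m g O V hg => ?_⟩
  have key : ∀ x y, (ruelle p)^[m + 1 + N₀] g x - (ruelle p)^[m + 1 + N₀] g y ≤
      (1 - δ ^ (m + 1 + N₀)) * O + δ ^ (m + 1 + N₀) * (V * ρ ^ (m + 1)) := by
    intro x y
    obtain ⟨w, hw, hwx⟩ := hN (m + 1) x x
    obtain ⟨w', hw', hwy⟩ := hN (m + 1) x y
    have hww : |g w - g w'| ≤ V * ρ ^ (m + 1) :=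
      hg.2 m _ _ fun k hk => (hw k hk).trans (hw' k hk).symm
    obtain ⟨z₁, -, hz₁⟩ := isCompact_univ.exists_isMinOn (s := (Set.univ : Set (SFT A)))
      Set.univ_nonempty g.continuous.continuousOn
    obtain ⟨z₂, -, hz₂⟩ := isCompact_univ.exists_isMaxOn (s := (Set.univ : Set (SFT A)))
      Set.univ_nonempty g.continuous.continuousOn
    have h1 := hlow (m + 1 + N₀) (g z₂ • 1 - g)
      (fun z => by simpa using hz₂ (Set.mem_univ z)) w
    have h2 := hlow (m + 1 + N₀) (g - g z₁ • 1)
      (fun z => by simpa using hz₁ (Set.mem_univ z)) w'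
    rw [iterate_sub, hp.iterate_smul_one, hwx] at h1
    rw [iterate_sub, hp.iterate_smul_one, hwy] at h2
    simp only [ContinuousMap.sub_apply, ContinuousMap.smul_apply, ContinuousMap.one_apply,
      smul_eq_mul, mul_one] at h1 h2
    have h3 := (abs_le.1 (hg.1 z₂ z₁)).2
    have h4 := (abs_le.1 hww).2
    have hd0 : 0 ≤ δ ^ (m + 1 + N₀) := by positivity
    have hd1 : δ ^ (m + 1 + N₀) ≤ 1 := pow_le_one₀ hδ.le hδ1
    nlinarith [mul_le_mul_of_nonneg_left h3 (sub_nonneg.2 hd1),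
      mul_le_mul_of_nonneg_left h4 hd0]
  intro x y
  rw [abs_le]
  constructor <;> linarith [key x y, key y x]

/-- Some power of the normalized Ruelle operator contracts a Hölder seminorm. -/
theorem exists_contraction (hp : NormalizedWeight p ρ B) (hmix : Mixing A) :
    ∃ (N : ℕ) (θ ε : ℝ), 0 ≤ θ ∧ θ < 1 ∧ 0 < ε ∧ ε ≤ 1 ∧ ∀ q (g : C(SFT A, ℝ)),
      OscHol ρ g q (q / ε) → OscHol ρ ((ruelle p)^[N] g) (θ * q) (θ * q / ε) := by
  obtain ⟨N₀, δ, hδ, hδ1, hosc⟩ := hp.osc_iterate_le hmix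
  have h1ρ : 0 < 1 - ρ := sub_pos.2 hp.rho_lt_one
  have hρ := hp.rho_pos
  have hB := hp.B_nonneg
  set C := Real.exp B * B / (1 - ρ) with hC
  have hC0 : 0 ≤ C := by positivity
  set ε := 1 / (4 * C + 1) with hε
  have hε0 : 0 < ε := by positivity
  have hε1 : ε ≤ 1 := by rw [hε, div_le_one (by positivity)]; linarith
  have hCε : C * ε ≤ 1 / 4 := by
    rw [hε, mul_one_div, div_le_div_iff₀ (by positivity) (by norm_num)]; linarith
  obtain ⟨m, hm⟩ := exists_pow_lt_of_lt_one (show 0 < ε / 4 by positivity) hp.rho_lt_one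
  have hm1 : ρ ^ (m + 1) ≤ ε / 4 :=
    (pow_le_pow_of_le_one hρ.le hp.rho_lt_one.le (Nat.le_succ m)).trans hm.le
  set N := m + 1 + N₀ with hN
  have hmN : ρ ^ N ≤ ε / 4 :=
    (pow_le_pow_of_le_one hρ.le hp.rho_lt_one.le (by omega : m ≤ N)).trans hm.le
  have hd0 : 0 < δ ^ N := by positivity
  have hd1 : δ ^ N ≤ 1 := pow_le_one₀ hδ.le hδ1
  refine ⟨N, 1 - δ ^ N / 2, ε, by linarith, by linarith, hε0, hε1, fun q g hg => ?_⟩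
  have hq := hg.nonneg
  have hqε : ρ ^ (m + 1) * (q / ε) ≤ q / 4 := by
    calc ρ ^ (m + 1) * (q / ε) ≤ ε / 4 * (q / ε) := by gcongr
      _ = q / 4 := by field_simp
  refine ⟨fun x y => (hosc m g q _ hg x y).trans ?_, ?_⟩
  · nlinarith
  · refine ((hp.oscHol_iterate hg N).mono hρ.le le_rfl ?_).2
    rw [← hC, mul_div_assoc' _ q ε, div_add' _ _ _ hε0.ne', div_le_div_iff_of_pos_right hε0]
    have h5 : ρ ^ N * q ≤ 1 / 4 * q := by gcongr; linarith
    have h6 : C * q * ε ≤ 1 / 4 * q := by nlinarith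
    nlinarith

/-- Bounded solvability of the Poisson equation `h - L h = u` for Hölder functions of mean
zero. -/
theorem exists_poisson (hp : NormalizedWeight p ρ B) (hmix : Mixing A) :
    ∃ K : ℝ, 0 ≤ K ∧ ∀ m : C(SFT A, ℝ) →L[ℝ] ℝ, (∀ g, 0 ≤ g → 0 ≤ m g) → m 1 = 1 →
      (∀ g, m (ruelle p g) = m g) → ∀ q u, m u = 0 → OscHol ρ u q q →
        ∃ h, h - ruelle p h = u ∧ ‖h‖ ≤ K * q := by
  obtain ⟨N, θ, ε, hθ0, hθ1, hε0, hε1, hcontr⟩ := hp.exists_contraction hmix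
  have h1θ : 0 < 1 - θ := sub_pos.2 hθ1
  refine ⟨N * (1 / (1 - θ)), by positivity, fun m hpos hone hinv q u hu hq => ?_⟩
  have hq0 := hq.nonneg
  set P : C(SFT A, ℝ) →L[ℝ] C(SFT A, ℝ) := ruelle p ^ N with hP
  have hPapply : ∀ k g, (ruelle p ^ k) g = (ruelle p)^[k] g := fun k g => by
    induction k with
    | zero => rfl
    | succ k ih =>
      rw [pow_succ', mul_apply_eq_comp, Function.iterate_succ_apply', ih]
  have hminv : ∀ k g, m ((ruelle p)^[k] g) = m g := by
    intro k g
    induction k with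
    | zero => rfl
    | succ k ih => rw [Function.iterate_succ_apply', hinv, ih]
  have hosc : ∀ k, OscHol ρ ((P ^ k) u) (θ ^ k * q) (θ ^ k * q / ε) ∧ m ((P ^ k) u) = 0 := by
    intro k
    induction k with
    | zero =>
      refine ⟨hq.mono hp.rho_pos.le (by simp) ?_, hu⟩
      rw [pow_zero, one_mul, le_div_iff₀ hε0]
      exact mul_le_of_le_one_right hq0 hε1
    | succ k ih =>
      have hk : (P ^ (k + 1)) u = (ruelle p)^[N] ((P ^ k) u) := by
        rw [pow_succ', mul_apply_eq_comp, hP, hPapply]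
      rw [hk, hminv, pow_succ', mul_assoc]
      exact ⟨hcontr _ _ ih.1, ih.2⟩
  have hsup : ∀ (g : C(SFT A, ℝ)) (O V : ℝ), OscHol ρ g O V → m g = 0 → ‖g‖ ≤ O := by
    intro g O V hg hm
    rw [ContinuousMap.norm_le _ hg.nonneg]
    intro x
    have h1 := hpos (g - (g x - O) • 1) (fun z => by
      simpa using by linarith [(abs_le.1 (hg.1 x z)).2])
    have h2 := hpos ((g x + O) • 1 - g) (fun z => by
      simpa using by linarith [(abs_le.1 (hg.1 x z)).1])
    simp only [map_sub, map_smul, hone, hm, smul_eq_mul] at h1 h2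
    rw [Real.norm_eq_abs, abs_le]
    constructor <;> linarith
  have hbound : ∀ k, ‖(P ^ k) u‖ ≤ q * θ ^ k := fun k => by
    rw [mul_comm]; exact hsup _ _ _ (hosc k).1 (hosc k).2
  have hgeo : HasSum (fun k => q * θ ^ k) (q * (1 - θ)⁻¹) :=
    (hasSum_geometric_of_lt_one hθ0 hθ1).mul_left q
  have hsum : Summable fun k => (P ^ k) u := Summable.of_norm_bounded hgeo.summable hbound
  set h₀ := ∑' k, (P ^ k) u with hh₀
  have hh₀norm : ‖h₀‖ ≤ q * (1 - θ)⁻¹ := tsum_of_norm_bounded hgeo hbound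
  have hfix : h₀ - P h₀ = u := by
    rw [sub_eq_iff_eq_add, hh₀, P.map_tsum hsum, hsum.tsum_eq_zero_add, pow_zero,
      one_apply_eq_self]
    simp only [pow_succ', mul_apply_eq_comp]
  refine ⟨(∑ j ∈ Finset.range N, ruelle p ^ j) h₀, ?_, ?_⟩
  · have := congrArg (fun T : C(SFT A, ℝ) →L[ℝ] C(SFT A, ℝ) => T h₀)
      (mul_neg_geom_sum (ruelle p) N)
    simp only [mul_apply_eq_comp, sub_apply,
      one_apply_eq_self] at this
    rw [this, ← hP, hfix]
  · rw [sum_apply]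
    have hj : ∀ j, ‖(ruelle p ^ j) h₀‖ ≤ q * (1 - θ)⁻¹ := by
      intro j
      induction j with
      | zero => exact hh₀norm
      | succ j ih =>
        rw [pow_succ', mul_apply_eq_comp]
        exact (hp.norm_ruelle_le _).trans ih
    refine (norm_sum_le_of_le _ fun j _ => hj j).trans (le_of_eq ?_)
    rw [Finset.sum_const, Finset.card_range, nsmul_eq_mul]
    ring

end NormalizedWeight

end Symbolic

section Symbolic

variable {a : ℕ} {A : Fin a → Fin a → Bool}

/-- The indicator of `{x | x k = j}`. -/
def symbolIndicator (A : Fin a → Fin a → Bool) (k : ℕ) (j : Fin a) : C(SFT A, ℝ) where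
  toFun x := if x.1 k = j then 1 else 0
  continuous_toFun := (continuous_of_discreteTopology
    (f := fun l : Fin a => if l = j then (1 : ℝ) else 0)).comp
      ((continuous_apply k).comp continuous_subtype_val)

theorem symbolIndicator_apply (k : ℕ) (j : Fin a) (x : SFT A) :
    symbolIndicator A k j x = if x.1 k = j then 1 else 0 := rfl

/-- The indicator of the cylinder `[c₀,…,c_{n-1}]`. -/
def cylIndicator (A : Fin a → Fin a → Bool) : ℕ → (ℕ → Fin a) → C(SFT A, ℝ)
  | 0, _ => 1
  | n + 1, c => (cylIndicator A n (shift c)).comp shiftX * symbolIndicator A 0 (c 0)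

open Classical in
theorem cylIndicator_apply (n : ℕ) (c : ℕ → Fin a) (x : SFT A) :
    cylIndicator A n c x = if ∀ k < n, x.1 k = c k then 1 else 0 := by
  induction n generalizing c x with
  | zero => simp [cylIndicator]
  | succ n ih =>
    have h : (∀ k < n + 1, x.1 k = c k) ↔
        (∀ k < n, (shiftX x).1 k = shift c k) ∧ x.1 0 = c 0 := by
      refine ⟨fun h => ⟨fun k hk => h (k + 1) (by omega), h 0 n.succ_pos⟩, fun h k hk => ?_⟩
      cases k with
      | zero => exact h.2
      | succ k => exact h.1 k (by omega)
    rw [if_congr h rfl rfl, cylIndicator, ContinuousMap.mul_apply, ContinuousMap.comp_apply, ih,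
      symbolIndicator_apply, ite_and]
    split_ifs <;> simp

theorem cylIndicator_nonneg (n : ℕ) (c : ℕ → Fin a) : 0 ≤ cylIndicator A n c := by
  classical
  intro x
  change 0 ≤ cylIndicator A n c x
  rw [cylIndicator_apply]
  split_ifs
  · exact zero_le_one
  · exact le_rfl

/-- Nonnegative functions whose logarithm is Hölder continuous on cylinders of positive length,
with the convention `log 0 = -∞`. -/
def LogHolder (ρ : ℝ) (u : C(SFT A, ℝ)) (B : ℝ) : Prop :=
  0 ≤ u ∧ ∀ n x y, Agree (n + 1) x y → u x ≤ Real.exp (B * ρ ^ (n + 1)) * u y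

theorem OscHol.sub {ρ : ℝ} {g h : C(SFT A, ℝ)} {O V O' V' : ℝ} (hg : OscHol ρ g O V)
    (hh : OscHol ρ h O' V') : OscHol ρ (g - h) (O + O') (V + V') := by
  have key : ∀ x y, |(g - h) x - (g - h) y| ≤ |g x - g y| + |h x - h y| := fun x y => by
    rw [ContinuousMap.sub_apply, ContinuousMap.sub_apply, sub_sub_sub_comm]
    exact abs_sub _ _
  exact ⟨fun x y => (key x y).trans (add_le_add (hg.1 x y) (hh.1 x y)), fun n x y hxy =>
    (key x y).trans ((add_le_add (hg.2 n x y hxy) (hh.2 n x y hxy)).trans_eq (add_mul _ _ _).symm)⟩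

theorem OscHol.smul {ρ : ℝ} {g : C(SFT A, ℝ)} {O V : ℝ} (hg : OscHol ρ g O V) (r : ℝ) :
    OscHol ρ (r • g) (|r| * O) (|r| * V) := by
  have key : ∀ x y, |(r • g) x - (r • g) y| = |r| * |g x - g y| := fun x y => by
    rw [ContinuousMap.smul_apply, ContinuousMap.smul_apply, ← smul_sub, smul_eq_mul, abs_mul]
  refine ⟨fun x y => ?_, fun n x y hxy => ?_⟩
  · rw [key]
    exact mul_le_mul_of_nonneg_left (hg.1 x y) (abs_nonneg r)
  · rw [key, mul_assoc]
    exact mul_le_mul_of_nonneg_left (hg.2 n x y hxy) (abs_nonneg r)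

theorem oscHol_smul_one {ρ : ℝ} (r : ℝ) : OscHol ρ (r • (1 : C(SFT A, ℝ))) 0 0 := by
  constructor <;> simp

theorem oscHol_of_forall_agree {ρ : ℝ} (hρ : 0 < ρ) (hρ1 : ρ < 1) {g : C(SFT A, ℝ)} {N : ℕ}
    (hg : ∀ x y, Agree N x y → g x = g y) : OscHol ρ g (2 * ‖g‖) (2 * ‖g‖ / ρ ^ N) := by
  have hosc : ∀ x y, |g x - g y| ≤ 2 * ‖g‖ := fun x y => by
    have h1 := g.norm_coe_le_norm x
    have h2 := g.norm_coe_le_norm y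
    rw [Real.norm_eq_abs] at h1 h2
    linarith [abs_sub (g x) (g y)]
  refine ⟨hosc, fun n x y hxy => ?_⟩
  by_cases hn : N ≤ n + 1
  · rw [hg x y (hxy.mono hn), sub_self, abs_zero]
    positivity
  · refine (hosc x y).trans ?_
    rw [div_mul_eq_mul_div, le_div_iff₀ (pow_pos hρ N)]
    exact mul_le_mul_of_nonneg_left (pow_le_pow_of_le_one hρ.le hρ1.le (not_le.1 hn).le)
      (by positivity)

/-- The algebra of functions depending on finitely many coordinates. -/
def finiteRange (A : Fin a → Fin a → Bool) : Subalgebra ℝ C(SFT A, ℝ) where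
  carrier := {g | ∃ n, ∀ x y, Agree n x y → g x = g y}
  mul_mem' := by
    rintro g h ⟨n, hn⟩ ⟨m, hm⟩
    exact ⟨max n m, fun x y hxy => congrArg₂ (· * ·) (hn x y (hxy.mono (le_max_left n m)))
      (hm x y (hxy.mono (le_max_right n m)))⟩
  add_mem' := by
    rintro g h ⟨n, hn⟩ ⟨m, hm⟩
    exact ⟨max n m, fun x y hxy => congrArg₂ (· + ·) (hn x y (hxy.mono (le_max_left n m)))
      (hm x y (hxy.mono (le_max_right n m)))⟩
  algebraMap_mem' r := ⟨0, fun _ _ _ => rfl⟩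

theorem dense_finiteRange : Dense (finiteRange A : Set C(SFT A, ℝ)) := by
  have h := ContinuousMap.subalgebra_topologicalClosure_eq_top_of_separatesPoints
    (finiteRange A) ?_
  · rw [dense_iff_closure_eq, ← Subalgebra.topologicalClosure_coe, h, Algebra.coe_top]
  · intro x y hxy
    obtain ⟨k, hk⟩ : ∃ k, x.1 k ≠ y.1 k := by
      by_contra! hcon
      exact hxy (Subtype.ext (funext hcon))
    refine ⟨_, ⟨symbolIndicator A k (x.1 k), ⟨k + 1, fun z w hzw => ?_⟩, rfl⟩, ?_⟩
    · rw [symbolIndicator_apply, symbolIndicator_apply, hzw k k.lt_succ_self]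
    · change symbolIndicator A k (x.1 k) x ≠ symbolIndicator A k (x.1 k) y
      rw [symbolIndicator_apply, symbolIndicator_apply, if_pos rfl, if_neg hk.symm]
      exact one_ne_zero

variable [Nonempty (SFT A)] {p : C(SFT A, ℝ)} {ρ B : ℝ}

theorem ruelle_symbolIndicator_mul (j : Fin a) (ψ : C(SFT A, ℝ)) (x : SFT A) :
    ruelle p (symbolIndicator A 0 j * ψ) x =
      if A j (x.1 0) = true then p (branch j x) * ψ (branch j x) else 0 := by
  rw [ruelle_apply, Finset.sum_eq_single j]
  · refine if_ctx_congr Iff.rfl (fun h => ?_) fun _ => rfl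
    rw [ContinuousMap.mul_apply, symbolIndicator_apply, branch_val h, if_pos (by rfl), one_mul]
  · intro i _ hij
    split_ifs with h
    · rw [ContinuousMap.mul_apply, symbolIndicator_apply, branch_val h, if_neg (by exact hij),
        zero_mul, mul_zero]
    · rfl
  · exact fun h => (h (Finset.mem_univ j)).elim

namespace NormalizedWeight

theorem logHolder_iterate (hp : NormalizedWeight p ρ B) {B' : ℝ} (hB' : B + B' * ρ ≤ B') (n : ℕ)
    (c : ℕ → Fin a) {ψ : C(SFT A, ℝ)} (hψ : LogHolder ρ ψ B') :
    LogHolder ρ ((ruelle p)^[n] (cylIndicator A n c * ψ)) B' := by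
  induction n generalizing c ψ with
  | zero => simpa [cylIndicator] using hψ
  | succ n ih =>
    rw [Function.iterate_succ_apply, cylIndicator, mul_assoc, ruelle_comp_shiftX_mul]
    refine ih _ ⟨hp.ruelle_nonneg (mul_nonneg (fun x => ?_) hψ.1), fun k x y hxy => ?_⟩
    · change 0 ≤ symbolIndicator A 0 (c 0) x
      rw [symbolIndicator_apply]
      split_ifs
      · exact zero_le_one
      · exact le_rfl
    · rw [ruelle_symbolIndicator_mul, ruelle_symbolIndicator_mul, ← hxy 0 k.succ_pos]
      split_ifs
      · have hb := hxy.branch (c 0)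
        have hρ := pow_pos hp.rho_pos (k + 1)
        calc p (branch (c 0) x) * ψ (branch (c 0) x)
            ≤ (Real.exp (B * ρ ^ (k + 1)) * p (branch (c 0) y)) *
              (Real.exp (B' * ρ ^ (k + 1 + 1)) * ψ (branch (c 0) y)) :=
              mul_le_mul (hp.distortion _ _ _ hb) (hψ.2 _ _ _ hb) (hψ.1 _)
                (mul_nonneg (Real.exp_pos _).le (hp.pos _).le)
          _ = Real.exp ((B + B' * ρ) * ρ ^ (k + 1)) *
              (p (branch (c 0) y) * ψ (branch (c 0) y)) := by
              rw [show (B + B' * ρ) * ρ ^ (k + 1) = B * ρ ^ (k + 1) + B' * ρ ^ (k + 1 + 1) by ring,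
                Real.exp_add]
              ring
          _ ≤ _ := by
              refine mul_le_mul_of_nonneg_right (Real.exp_le_exp.2 ?_)
                (mul_nonneg (hp.pos _).le (hψ.1 _))
              exact mul_le_mul_of_nonneg_right hB' hρ.le
      · simp

theorem map_iterate {m : C(SFT A, ℝ) →L[ℝ] ℝ} (hinv : ∀ g, m (ruelle p g) = m g) (k : ℕ)
    (g : C(SFT A, ℝ)) : m ((ruelle p)^[k] g) = m g := by
  induction k with
  | zero => rfl
  | succ k ih => rw [Function.iterate_succ_apply', hinv, ih]

theorem exists_oscHol_of_logHolder (hp : NormalizedWeight p ρ B) (hmix : Mixing A) {B' : ℝ}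
    (hB' : 0 ≤ B') :
    ∃ K : ℝ, 0 ≤ K ∧ ∀ m : C(SFT A, ℝ) →L[ℝ] ℝ, (∀ g, 0 ≤ g → 0 ≤ m g) → m 1 = 1 →
      (∀ g, m (ruelle p g) = m g) → ∀ u, LogHolder ρ u B' →
        OscHol ρ u (K * m u) (K * m u) := by
  obtain ⟨N, hN⟩ := hmix.exists_connecting
  obtain ⟨δ, hδ, hδ1, hlow⟩ := hp.exists_lower_bound
  set K₀ := Real.exp B' / δ ^ (1 + N) with hK₀
  have hK₀0 : 0 ≤ K₀ := by positivity
  refine ⟨K₀ * (1 + Real.exp B' * B'), by positivity, fun m hpos hone hinv u hu => ?_⟩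
  have hmu : 0 ≤ m u := hpos u hu.1
  have hexp : ∀ n, B' * ρ ^ (n + 1) ≤ B' := fun n =>
    mul_le_of_le_one_right hB' (pow_le_one₀ hp.rho_pos.le hp.rho_lt_one.le)
  have hsup : ∀ x, u x ≤ K₀ * m u := by
    intro x
    have h1 : (δ ^ (1 + N) * (Real.exp (-B') * u x)) • (1 : C(SFT A, ℝ)) ≤
        (ruelle p)^[1 + N] u := by
      intro y
      obtain ⟨w, hw, hwy⟩ := hN 1 x y
      have h2 := hlow (1 + N) u hu.1 w
      rw [hwy] at h2
      have h3 : Real.exp (-B') * u x ≤ u w := by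
        rw [Real.exp_neg, inv_mul_le_iff₀ (Real.exp_pos B')]
        exact (hu.2 0 x w hw.symm).trans
          (mul_le_mul_of_nonneg_right (Real.exp_le_exp.2 (hexp 0)) (hu.1 w))
      simpa using (mul_le_mul_of_nonneg_left h3 (by positivity)).trans h2
    have h4 := hpos _ (sub_nonneg.2 h1)
    rw [map_sub, map_smul, hone, map_iterate hinv, smul_eq_mul, mul_one, sub_nonneg,
      Real.exp_neg] at h4
    rw [hK₀, div_mul_eq_mul_div, le_div_iff₀ (by positivity)]
    calc u x * δ ^ (1 + N)
        = Real.exp B' * (δ ^ (1 + N) * ((Real.exp B')⁻¹ * u x)) := by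
          field_simp
      _ ≤ Real.exp B' * m u := mul_le_mul_of_nonneg_left h4 (Real.exp_pos _).le
  have h0 : ∀ x, 0 ≤ u x := hu.1
  have hE : 0 ≤ Real.exp B' * B' := by positivity
  have hKm : 0 ≤ K₀ * m u := by positivity
  refine ⟨fun x y => ?_, fun n x y hxy => ?_⟩
  · rw [abs_le]
    constructor <;> nlinarith [hsup x, hsup y, h0 x, h0 y]
  · have hρ := pow_pos hp.rho_pos (n + 1)
    have h := abs_sub_le_of_le_exp_mul (mul_nonneg hB' hρ.le) (hexp n) (h0 y) (hu.2 n x y hxy)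
      (hu.2 n y x hxy.symm)
    calc |u x - u y| ≤ Real.exp B' * (B' * ρ ^ (n + 1)) * u y := h
      _ ≤ Real.exp B' * (B' * ρ ^ (n + 1)) * (K₀ * m u) := by
          gcongr
          exact hsup y
      _ = (Real.exp B' * B') * (K₀ * m u) * ρ ^ (n + 1) := by ring
      _ ≤ K₀ * (1 + Real.exp B' * B') * m u * ρ ^ (n + 1) := by
          refine mul_le_mul_of_nonneg_right ?_ hρ.le
          nlinarith

theorem dense_coboundary (hp : NormalizedWeight p ρ B) (hmix : Mixing A)
    {m : C(SFT A, ℝ) →L[ℝ] ℝ} (hpos : ∀ g, 0 ≤ g → 0 ≤ m g) (hone : m 1 = 1)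
    (hinv : ∀ g, m (ruelle p g) = m g) {ψ : C(SFT A, ℝ)} (hmψ : m ψ = 1) {O V : ℝ}
    (hψ : OscHol ρ ψ O V) :
    Dense {g : C(SFT A, ℝ) | ∃ h, ∃ r : ℝ, g = h - ruelle p h + r • ψ} := by
  obtain ⟨K, -, hK⟩ := hp.exists_poisson hmix
  refine dense_finiteRange.mono ?_
  rintro g ⟨N, hN⟩
  have hosc := (oscHol_of_forall_agree hp.rho_pos hp.rho_lt_one hN).sub (hψ.smul (m g))
  obtain ⟨h, hh, -⟩ := hK m hpos hone hinv _ (g - m g • ψ)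
    (by rw [map_sub, map_smul, hmψ, smul_eq_mul, mul_one, sub_self])
    (hosc.mono hp.rho_pos.le (le_max_left _ _) (le_max_right _ _))
  exact ⟨h, m g, by rw [hh, sub_add_cancel]⟩

end NormalizedWeight

end Symbolic

section Symbolic

variable {a d : ℕ} {A : Fin a → Fin a → Bool}

theorem LogHolder.mono {ρ : ℝ} (hρ : 0 ≤ ρ) {u : C(SFT A, ℝ)} {B B' : ℝ} (hu : LogHolder ρ u B)
    (hB : B ≤ B') : LogHolder ρ u B' :=
  ⟨hu.1, fun n x y hxy => (hu.2 n x y hxy).trans (mul_le_mul_of_nonneg_right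
    (Real.exp_le_exp.2 (mul_le_mul_of_nonneg_right hB (by positivity))) (hu.1 y))⟩

/-- Composition with the shift, as an operation on functions. -/
def koopman (b : C(SFT A, ℝ)) : C(SFT A, ℝ) := b.comp shiftX

theorem koopman_iterate_apply (k : ℕ) (b : C(SFT A, ℝ)) (x : SFT A) :
    koopman^[k] b x = b (shiftX^[k] x) := by
  induction k generalizing x with
  | zero => rfl
  | succ k ih =>
    rw [Function.iterate_succ_apply', Function.iterate_succ_apply]
    exact ih (shiftX x)

variable [Nonempty (SFT A)] {p : C(SFT A, ℝ)} {ρ B : ℝ}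

theorem iterate_ruelle_koopman_mul (k : ℕ) (b g : C(SFT A, ℝ)) :
    (ruelle p)^[k] (koopman^[k] b * g) = b * (ruelle p)^[k] g := by
  induction k generalizing g with
  | zero => rfl
  | succ k ih =>
    rw [Function.iterate_succ_apply, Function.iterate_succ_apply', koopman,
      ruelle_comp_shiftX_mul, ih, ← Function.iterate_succ_apply]

theorem sum_iterate_sub (p g : C(SFT A, ℝ)) (n : ℕ) :
    ∑ k ∈ Finset.range n, (ruelle p)^[k] g - ruelle p (∑ k ∈ Finset.range n, (ruelle p)^[k] g) =
      g - (ruelle p)^[n] g := by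
  rw [map_sum, ← Finset.sum_sub_distrib]
  simp only [← Function.iterate_succ_apply' (ruelle p)]
  exact Finset.sum_range_sub' (fun k => (ruelle p)^[k] g) n

theorem NormalizedWeight.exists_abs_fderiv_log_sub_le (hp : NormalizedWeight p ρ B)
    (hmix : Mixing A) {f : Fin d → C(SFT A, ℝ)} {t : Fin d → ℝ}
    {m : (Fin d → ℝ) → C(SFT A, ℝ) →L[ℝ] ℝ} {κ : (Fin d → ℝ) → ℝ} {C c : ℝ}
    (heig : ∀ s g, m s (ruelle p (expPert f t s * g)) = κ s * m s g) (hC : ∀ s, ‖m s‖ ≤ C)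
    (hc : 0 < c) (hm : ∀ s, c ≤ m s 1) {ψ : C(SFT A, ℝ)} (hψ : ∀ s, m s ψ = 1) {O V B₁ : ℝ}
    (hψosc : OscHol ρ ψ O V) (hψlog : LogHolder ρ ψ B₁) (hpos : ∀ g, 0 ≤ g → 0 ≤ m t g)
    (hone : m t 1 = 1) (hinv : ∀ g, m t (ruelle p g) = m t g) (i : Fin d) :
    ∃ K : ℝ, ∀ n (w : ℕ → Fin a), m t (cylIndicator A n w * ψ) ≠ 0 →
      |fderiv ℝ (fun s => Real.log (m s (cylIndicator A n w * ψ))) t (Pi.single i 1) -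
        (1 / m t (cylIndicator A n w * ψ)) *
          m t ((∑ k ∈ Finset.range n, koopman^[k] (f i - m t (f i) • 1)) *
            (cylIndicator A n w * ψ))| ≤ K := by
  have h1ρ : 0 < 1 - ρ := sub_pos.2 hp.rho_lt_one
  set B' := max B₁ (B / (1 - ρ)) with hB'
  have hB'0 : 0 ≤ B' := (div_nonneg hp.B_nonneg h1ρ.le).trans (le_max_right _ _)
  have hBB : B + B' * ρ ≤ B' := by
    have := (div_le_iff₀ h1ρ).1 (le_max_right B₁ (B / (1 - ρ)))
    rw [← hB'] at this
    linarith
  obtain ⟨K₁, hK₁, hpoisson⟩ := hp.exists_poisson hmix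
  obtain ⟨K₂, hK₂, hosc⟩ := hp.exists_oscHol_of_logHolder hmix hB'0
  have hdense := hp.dense_coboundary hmix hpos hone hinv (hψ t) hψosc
  obtain ⟨e, he, -⟩ := hpoisson (m t) hpos hone hinv _ (ψ - (1 : ℝ) • 1)
    (by rw [map_sub, map_smul, hψ, hone, smul_eq_mul, mul_one, sub_self])
    ((hψosc.sub (oscHol_smul_one 1)).mono hp.rho_pos.le (le_max_left _ _) (le_max_right _ _))
  set b := f i - m t (f i) • 1 with hb
  refine ⟨‖m t‖ * (‖b‖ * (K₁ * K₂)) + ‖m t‖ * (‖b‖ * ‖e‖), fun n w hv => ?_⟩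
  set g := cylIndicator A n w * ψ with hg
  set v := m t g with hvg
  have hv0 : 0 < v := lt_of_le_of_ne
    (hpos _ (mul_nonneg (cylIndicator_nonneg n w) hψlog.1)) (Ne.symm hv)
  have hmu : m t ((ruelle p)^[n] g) = v := NormalizedWeight.map_iterate hinv n g
  have hu := hosc (m t) hpos hone hinv _
    (hp.logHolder_iterate hBB n w (hψlog.mono hp.rho_pos.le (le_max_left _ _)))
  rw [← hg, hmu] at hu
  obtain ⟨h₁, hh₁, hh₁n⟩ := hpoisson (m t) hpos hone hinv (K₂ * v) ((ruelle p)^[n] g - v • 1)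
    (by rw [map_sub, map_smul, hmu, hone, smul_eq_mul, mul_one, sub_self])
    ((hu.sub (oscHol_smul_one v)).mono hp.rho_pos.le (add_zero _).le (add_zero _).le)
  set h := ∑ k ∈ Finset.range n, (ruelle p)^[k] g + h₁ - v • e with hh
  have hcob : h - ruelle p h = g - v • ψ := by
    have h1 := sum_iterate_sub p g n
    rw [hh, map_sub, map_add, map_smul]
    linear_combination (norm := module) h1 + hh₁ - v • he
  have hderiv := (hasFDerivAt_apply_sub hp.ruelle_one heig hC hc hm hψ hdense hone hinv h).add_const v
  have hfun : (fun s => m s (h - ruelle p h) + v) = fun s => m s g := by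
    funext s
    rw [hcob, map_sub, map_smul, hψ, smul_eq_mul, mul_one, sub_add_cancel]
  rw [hfun] at hderiv
  rw [(hderiv.log hv).fderiv]
  have hsum : m t (b * h) = m t ((∑ k ∈ Finset.range n, koopman^[k] b) * g) +
      m t (b * h₁) - v * m t (b * e) := by
    rw [hh, mul_sub, mul_add, map_sub, map_add, mul_smul_comm, map_smul, smul_eq_mul,
      Finset.mul_sum, Finset.sum_mul, map_sum, map_sum]
    congr 2
    refine Finset.sum_congr rfl fun k _ => ?_
    rw [← iterate_ruelle_koopman_mul, NormalizedWeight.map_iterate hinv]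
  have hL : (∑ j, m t ((f j - m t (f j) • 1) * h) •
      (ContinuousLinearMap.proj j : (Fin d → ℝ) →L[ℝ] ℝ)) (Pi.single i 1) = m t (b * h) := by
    simp [Pi.single_apply, hb]
  have hb1 : |m t (b * h₁)| ≤ ‖m t‖ * (‖b‖ * (K₁ * K₂)) * v := by
    calc |m t (b * h₁)| ≤ ‖m t‖ * ‖b * h₁‖ := (m t).le_opNorm _
      _ ≤ ‖m t‖ * (‖b‖ * (K₁ * (K₂ * v))) := by
        gcongr
        exact (norm_mul_le _ _).trans (by gcongr)
      _ = _ := by ring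
  have hb2 : |m t (b * e)| ≤ ‖m t‖ * (‖b‖ * ‖e‖) :=
    ((m t).le_opNorm _).trans (by gcongr; exact norm_mul_le _ _)
  rw [smul_apply, hL, hsum, smul_eq_mul, ← hvg]
  calc _ = |m t (b * h₁) / v - m t (b * e)| := by
        congr 1
        field_simp
        ring
    _ ≤ |m t (b * h₁) / v| + |m t (b * e)| := abs_sub _ _
    _ ≤ _ := by
      refine add_le_add ?_ hb2
      rw [abs_div, abs_of_pos hv0, div_le_iff₀ hv0]
      exact hb1

end Symbolic

section Concrete

variable {a d : ℕ} {A : Fin a → Fin a → Bool}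

theorem HolderSeq.exists_bound {f : (ℕ → Fin a) → ℝ} (hf : HolderSeq f) :
    ∃ C ρ : ℝ, 0 ≤ C ∧ 0 < ρ ∧ ρ < 1 ∧ ∀ ρ', ρ ≤ ρ' → ∀ n : ℕ, ∀ x y : ℕ → Fin a,
      (∀ i < n, x i = y i) → |f x - f y| ≤ C * ρ' ^ n := by
  obtain ⟨-, C, ρ, hρ, hρ1, h⟩ := hf
  refine ⟨max C 0, ρ, le_max_right _ _, hρ, hρ1, fun ρ' hρ' n x y hxy => (h n x y hxy).trans ?_⟩
  have hC := le_max_right C 0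
  gcongr
  exact le_max_left C 0

theorem HolderSeq.add {f g : (ℕ → Fin a) → ℝ} (hf : HolderSeq f) (hg : HolderSeq g) :
    HolderSeq fun x => f x + g x := by
  obtain ⟨C, ρ, -, hρ, hρ1, h⟩ := hf.exists_bound
  obtain ⟨C', ρ', -, hρ', hρ'1, h'⟩ := hg.exists_bound
  refine ⟨hf.1.add hg.1, C + C', max ρ ρ', lt_max_of_lt_left hρ, max_lt hρ1 hρ'1,
    fun n x y hxy => ?_⟩
  rw [add_sub_add_comm, add_mul]
  exact (abs_add_le _ _).trans
    (add_le_add (h _ (le_max_left _ _) n x y hxy) (h' _ (le_max_right _ _) n x y hxy))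

theorem HolderSeq.const_mul {f : (ℕ → Fin a) → ℝ} (hf : HolderSeq f) (r : ℝ) :
    HolderSeq fun x => r * f x := by
  obtain ⟨hc, C, ρ, hρ, hρ1, h⟩ := hf
  refine ⟨continuous_const.mul hc, |r| * C, ρ, hρ, hρ1, fun n x y hxy => ?_⟩
  rw [← mul_sub, abs_mul, mul_assoc]
  exact mul_le_mul_of_nonneg_left (h n x y hxy) (abs_nonneg r)

theorem holderSeq_Fpot {f₀ : (ℕ → Fin a) → ℝ} {f : Fin d → (ℕ → Fin a) → ℝ}
    (hf₀ : HolderSeq f₀) (hf : ∀ i, HolderSeq (f i)) (s : Fin d → ℝ) :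
    HolderSeq (Fpot f₀ f s) := by
  have hsum : ∀ S : Finset (Fin d), HolderSeq fun x => f₀ x + ∑ i ∈ S, s i * f i x := by
    intro S
    induction S using Finset.induction_on with
    | empty => simpa using hf₀
    | insert i S hi ih =>
      have := ih.add ((hf i).const_mul (s i))
      simpa only [Finset.sum_insert hi, add_assoc, add_comm (s i * f i _)] using this
  exact hsum Finset.univ

/-- Restriction of a continuous function to the subshift. -/
def restrictSFT (A : Fin a → Fin a → Bool) (F : (ℕ → Fin a) → ℝ) (hF : Continuous F) :
    C(SFT A, ℝ) :=
  ⟨fun x => F x.1, hF.comp continuous_subtype_val⟩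

theorem restrictSFT_apply {F : (ℕ → Fin a) → ℝ} (hF : Continuous F) (x : SFT A) :
    restrictSFT A F hF x = F x.1 := rfl

theorem norm_integral_comap_le (ν : Measure (ℕ → Fin a)) [IsProbabilityMeasure ν]
    (g : C(SFT A, ℝ)) :
    ‖∫ x, g x ∂(ν.comap (Subtype.val : SFT A → ℕ → Fin a))‖ ≤ 1 * ‖g‖ := by
  refine (norm_integral_le_of_norm_le_const (ae_of_all _ g.norm_coe_le_norm)).trans ?_
  rw [mul_comm]
  refine mul_le_mul_of_nonneg_right ?_ (norm_nonneg g)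
  rw [measureReal_def, comap_subtype_coe_apply isClosed_SFT.measurableSet]
  exact measureReal_le_one (μ := ν)

/-- The integration functional on the subshift. -/
noncomputable def integralSFT (A : Fin a → Fin a → Bool) (ν : Measure (ℕ → Fin a))
    [IsProbabilityMeasure ν] : C(SFT A, ℝ) →L[ℝ] ℝ :=
  have hintegrable : ∀ g : C(SFT A, ℝ), Integrable g (ν.comap Subtype.val) := fun g =>
    g.continuous.integrable_of_hasCompactSupport (HasCompactSupport.of_compactSpace g)
  LinearMap.mkContinuous
    { toFun := fun g => ∫ x, g x ∂(ν.comap (Subtype.val : SFT A → ℕ → Fin a))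
      map_add' := fun g h => integral_add (hintegrable g) (hintegrable h)
      map_smul' := fun r g => integral_const_mul r g } 1 (norm_integral_comap_le ν)

theorem integralSFT_apply (ν : Measure (ℕ → Fin a)) [IsProbabilityMeasure ν] (g : C(SFT A, ℝ)) :
    integralSFT A ν g = ∫ x, g x ∂(ν.comap (Subtype.val : SFT A → ℕ → Fin a)) := rfl

theorem integralSFT_nonneg (ν : Measure (ℕ → Fin a)) [IsProbabilityMeasure ν] {g : C(SFT A, ℝ)}
    (hg : 0 ≤ g) : 0 ≤ integralSFT A ν g :=
  integral_nonneg hg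

theorem integralSFT_eq {ν : Measure (ℕ → Fin a)} [IsProbabilityMeasure ν]
    (hν : ν (SFT A)ᶜ = 0) (g : C(SFT A, ℝ)) {F : (ℕ → Fin a) → ℝ} (hF : ∀ x : SFT A, F x.1 = g x) :
    integralSFT A ν g = ∫ x, F x ∂ν := by
  rw [integralSFT_apply, ← integral_congr_ae (ae_of_all _ hF),
    integral_subtype_comap isClosed_SFT.measurableSet,
    Measure.restrict_eq_self_of_ae_mem (s := SFT A) (mem_ae_iff.2 hν)]

theorem integralSFT_one {ν : Measure (ℕ → Fin a)} [IsProbabilityMeasure ν]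
    (hν : ν (SFT A)ᶜ = 0) : integralSFT A ν 1 = 1 := by
  rw [integralSFT_eq hν 1 (F := fun _ => 1) fun _ => rfl]
  simp

theorem abs_integralSFT_le {ν : Measure (ℕ → Fin a)} [IsProbabilityMeasure ν]
    (g : C(SFT A, ℝ)) : |integralSFT A ν g| ≤ ‖g‖ :=
  (norm_integral_comap_le ν g).trans_eq (one_mul _)

theorem measurableSet_cyl (n : ℕ) (c : ℕ → Fin a) : MeasurableSet (cyl A n c) := by
  have : cyl A n c = SFT A ∩ ⋂ k ∈ Finset.range n, {x : ℕ → Fin a | x k = c k} := by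
    ext x
    simp [cyl]
  rw [this]
  refine isClosed_SFT.measurableSet.inter (Finset.measurableSet_biInter _ fun k _ => ?_)
  exact measurable_pi_apply (X := fun _ : ℕ => Fin a) k (measurableSet_singleton (c k))

theorem integralSFT_mul_cylIndicator {ν : Measure (ℕ → Fin a)} [IsProbabilityMeasure ν]
    (hν : ν (SFT A)ᶜ = 0) (n : ℕ) (c : ℕ → Fin a) (g : C(SFT A, ℝ)) {F : (ℕ → Fin a) → ℝ}
    (hF : ∀ x : SFT A, F x.1 = g x) :
    integralSFT A ν (g * cylIndicator A n c) = ∫ x in cyl A n c, F x ∂ν := by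
  classical
  rw [← integral_indicator (measurableSet_cyl n c)]
  refine integralSFT_eq hν _ fun x => ?_
  rw [ContinuousMap.mul_apply, cylIndicator_apply, Set.indicator_apply, mul_ite, mul_one, mul_zero,
    hF]
  exact if_congr (and_iff_right x.2) rfl rfl

theorem integralSFT_cylIndicator {ν : Measure (ℕ → Fin a)} [IsProbabilityMeasure ν]
    (hν : ν (SFT A)ᶜ = 0) (n : ℕ) (c : ℕ → Fin a) :
    integralSFT A ν (cylIndicator A n c) = (ν (cyl A n c)).toReal := by
  rw [← one_mul (cylIndicator A n c), integralSFT_mul_cylIndicator hν n c 1 (F := fun _ => 1)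
    fun _ => rfl]
  simp [measureReal_def]

/-- The weight `exp ∘ F` on the subshift. -/
noncomputable def expWeight (A : Fin a → Fin a → Bool) (F : (ℕ → Fin a) → ℝ) (hF : Continuous F) :
    C(SFT A, ℝ) :=
  restrictSFT A (fun x => Real.exp (F x)) (Real.continuous_exp.comp hF)

theorem expWeight_apply {F : (ℕ → Fin a) → ℝ} (hF : Continuous F) (x : SFT A) :
    expWeight A F hF x = Real.exp (F x.1) := rfl

theorem expWeight_mul_expPert {f₀ : (ℕ → Fin a) → ℝ} {f : Fin d → (ℕ → Fin a) → ℝ}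
    (hf : ∀ i, Continuous (f i)) (t s : Fin d → ℝ) (ht : Continuous (Fpot f₀ f t))
    (hs : Continuous (Fpot f₀ f s)) :
    expWeight A _ ht * expPert (fun i => restrictSFT A (f i) (hf i)) t s = expWeight A _ hs := by
  ext x
  rw [ContinuousMap.mul_apply, expPert_apply, expWeight_apply, expWeight_apply, ← Real.exp_add]
  congr 1
  simp only [Fpot, restrictSFT_apply, sub_mul, Finset.sum_sub_distrib]
  ring

variable [Nonempty (SFT A)]

theorem sumPre_expWeight_mul {F : (ℕ → Fin a) → ℝ} (hF : Continuous F) {g : (ℕ → Fin a) → ℝ}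
    {g' : C(SFT A, ℝ)} (hg : ∀ x : SFT A, g x.1 = g' x) (x : SFT A) :
    transfer A F g x.1 = sumPre A (expWeight A F hF * g') x := by
  rw [sumPre_apply]
  refine Finset.sum_congr rfl fun i _ => if_ctx_congr Iff.rfl (fun h => ?_) fun _ => rfl
  rw [ContinuousMap.mul_apply, expWeight_apply, ← hg, branch_val h]

theorem Eigenmeasure.integralSFT_sumPre {F : (ℕ → Fin a) → ℝ} (hF : Continuous F) {lam : ℝ}
    {ν : Measure (ℕ → Fin a)} [IsProbabilityMeasure ν] (h : Eigenmeasure A F lam ν)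
    (g : C(SFT A, ℝ)) :
    integralSFT A ν (sumPre A (expWeight A F hF * g)) = lam * integralSFT A ν g := by
  obtain ⟨g', hg'⟩ := ContinuousMap.exists_restrict_eq isClosed_SFT g
  have hval : ∀ x : SFT A, g' x.1 = g x := fun x => DFunLike.congr_fun hg' x
  rw [integralSFT_eq h.2.1 g hval, ← h.2.2 g' g'.continuous]
  exact integralSFT_eq h.2.1 _ (sumPre_expWeight_mul hF hval)

end Concrete

section Concrete

variable {a : ℕ} {A : Fin a → Fin a → Bool}

theorem GibbsData.integral_μ (G : GibbsData a A) {F : (ℕ → Fin a) → ℝ} (hF : HolderSeq F)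
    [IsProbabilityMeasure (G.ν F)] (g : (ℕ → Fin a) → ℝ) (hg : Continuous g) :
    ∫ x, g x ∂(G.μ F) = integralSFT A (G.ν F)
      (restrictSFT A (G.φ F) (G.φ_holder F hF).1 * restrictSFT A g hg) := by
  rw [GibbsData.μ]
  refine (integral_withDensity_eq_integral_smul
    ((G.φ_holder F hF).1.measurable.real_toNNReal) g).trans
      (integralSFT_eq (G.eigen F hF).2.1 _ fun x => ?_).symm
  rw [ContinuousMap.mul_apply, restrictSFT_apply, restrictSFT_apply, NNReal.smul_def,
    Real.coe_toNNReal _ (G.φ_pos F hF _ x.2).le, smul_eq_mul]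

variable [Nonempty (SFT A)]

theorem HolderSeq.exists_le_exp_mul {φ : (ℕ → Fin a) → ℝ} (hφ : HolderSeq φ)
    (hpos : ∀ x ∈ SFT A, 0 < φ x) :
    ∃ c B ρ : ℝ, 0 < c ∧ (∀ x : SFT A, c ≤ φ x.1) ∧ 0 ≤ B ∧ 0 < ρ ∧ ρ < 1 ∧
      ∀ ρ', ρ ≤ ρ' → ∀ n (x y : SFT A), Agree n x y → φ x.1 ≤ Real.exp (B * ρ' ^ n) * φ y.1 := by
  obtain ⟨z, -, hz⟩ := isCompact_univ.exists_isMinOn (s := (Set.univ : Set (SFT A)))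
    Set.univ_nonempty (hφ.1.comp continuous_subtype_val).continuousOn
  have hz' : ∀ x : SFT A, φ z.1 ≤ φ x.1 := fun x => hz (Set.mem_univ x)
  have hc := hpos z.1 z.2
  obtain ⟨C, ρ, hC, hρ, hρ1, h⟩ := hφ.exists_bound
  refine ⟨φ z.1, C / φ z.1, ρ, hc, hz', by positivity, hρ, hρ1, fun ρ' hρ' n x y hxy => ?_⟩
  have h1 := (abs_le.1 (h ρ' hρ' n x.1 y.1 hxy)).2
  have hρ'n : 0 ≤ ρ' ^ n := pow_nonneg (hρ.le.trans hρ') n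
  have hy := hpos y.1 y.2
  calc φ x.1 ≤ φ y.1 + C / φ z.1 * ρ' ^ n * φ z.1 := by
        rw [div_mul_eq_mul_div, div_mul_cancel₀ _ hc.ne']
        linarith
    _ ≤ φ y.1 + C / φ z.1 * ρ' ^ n * φ y.1 := by
        gcongr
        exact hz' y
    _ = (C / φ z.1 * ρ' ^ n + 1) * φ y.1 := by ring
    _ ≤ _ := mul_le_mul_of_nonneg_right (Real.add_one_le_exp _) hy.le

theorem normalizedWeight_of_eigenfunction {E φ ψ : C(SFT A, ℝ)} {lam C B ρ : ℝ}
    (hlam : 0 < lam) (hC : 0 ≤ C) (hB : 0 ≤ B) (hρ : 0 < ρ) (hρ1 : ρ < 1) (hE : ∀ x, 0 < E x)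
    (hφ : ∀ x, 0 < φ x) (hψ : ∀ x, 0 < ψ x) (hψφ : ψ * φ = 1)
    (heig : sumPre A (E * φ) = lam • φ)
    (hE' : ∀ n x y, Agree n x y → E x ≤ Real.exp (C * ρ ^ n) * E y)
    (hφ' : ∀ n x y, Agree n x y → φ x ≤ Real.exp (B * ρ ^ n) * φ y)
    (hψ' : ∀ n x y, Agree n x y → ψ x ≤ Real.exp (B * ρ ^ n) * ψ y) :
    NormalizedWeight ((lam⁻¹ • ψ).comp shiftX * (E * φ)) ρ (C + 2 * B) where
  rho_pos := hρ
  rho_lt_one := hρ1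
  B_nonneg := by positivity
  pos x := mul_pos (mul_pos (inv_pos.2 hlam) (hψ _)) (mul_pos (hE x) (hφ x))
  normalized := by
    rw [sumPre_comp_shiftX_mul, heig, smul_mul_smul_comm, inv_mul_cancel₀ hlam.ne', one_smul, hψφ]
  distortion n x y hxy := by
    have hxy' := hxy.mono n.le_succ
    have h1 := hE' n x y hxy'
    have h2 := hφ' n x y hxy'
    have h3 := hψ' n (shiftX x) (shiftX y) fun k hk => hxy (k + 1) (by omega)
    have hexp : Real.exp ((C + 2 * B) * ρ ^ n) =
        Real.exp (B * ρ ^ n) * (Real.exp (C * ρ ^ n) * Real.exp (B * ρ ^ n)) := by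
      rw [← Real.exp_add, ← Real.exp_add]
      congr 1
      ring
    change lam⁻¹ * ψ (shiftX x) * (E x * φ x) ≤
      Real.exp ((C + 2 * B) * ρ ^ n) * (lam⁻¹ * ψ (shiftX y) * (E y * φ y))
    have hx := hψ (shiftX x)
    have hy := hψ (shiftX y)
    have hEx := hE x
    have hEy := hE y
    have hφx := hφ x
    calc lam⁻¹ * ψ (shiftX x) * (E x * φ x)
        ≤ lam⁻¹ * (Real.exp (B * ρ ^ n) * ψ (shiftX y)) *
          ((Real.exp (C * ρ ^ n) * E y) * (Real.exp (B * ρ ^ n) * φ y)) := by gcongr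
      _ = _ := by rw [hexp]; ring

end Concrete

end GibbsPaper

namespace GibbsPaper

/-- **Lemma 3.4.** Fix `t ∈ ℝ^d` and `i`.  There is a constant `K = K(t) < ∞`,
independent of `n` and of the cylinder, such that for all `n ≥ 1` and every cylinder
`C = [c₀,…,c_{n−1}]` with `ν_t(C) > 0`,
`| ∂ log ν_s(C)/∂s_i |_{s=t} − (1/ν_t(C)) ∫_C S_n f̃ᵢᵗ dν_t | ≤ K`,
where `f̃ᵢᵗ = f_i − ∫ f_i dμ_t`. -/
theorem lemma_3_4_derivative_of_log_cylinder_measure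
    {a d : ℕ} (ha : 2 ≤ a) (A : Fin a → Fin a → Bool) (hmix : Mixing A)
    (G : GibbsData a A)
    (f₀ : (ℕ → Fin a) → ℝ) (f : Fin d → (ℕ → Fin a) → ℝ)
    (hf₀ : HolderSeq f₀) (hf : ∀ i, HolderSeq (f i))
    (t : Fin d → ℝ) (i : Fin d) :
    ∃ K : ℝ, ∀ n : ℕ, 1 ≤ n → ∀ c : ℕ → Fin a,
      G.ν (Fpot f₀ f t) (cyl A n c) ≠ 0 →
      |fderiv ℝ (fun s : Fin d → ℝ =>
            Real.log ((G.ν (Fpot f₀ f s) (cyl A n c)).toReal)) t (Pi.single i 1) -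
        (1 / (G.ν (Fpot f₀ f t) (cyl A n c)).toReal) *
          ∫ x in cyl A n c,
            birkhoff n (fun y => f i y - ∫ z, f i z ∂(G.μ (Fpot f₀ f t))) x
              ∂(G.ν (Fpot f₀ f t))| ≤ K := by
  have hF := fun s => holderSeq_Fpot hf₀ hf s
  have hprob : ∀ s, IsProbabilityMeasure (G.ν (Fpot f₀ f s)) := fun s => (G.eigen _ (hF s)).1
  have hsupp : ∀ s, G.ν (Fpot f₀ f s) (SFT A)ᶜ = 0 := fun s => (G.eigen _ (hF s)).2.1
  have : Nonempty (SFT A) := by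
    by_contra hne
    have h := hsupp t
    rw [Set.not_nonempty_iff_eq_empty.1 (mt Set.Nonempty.to_subtype hne), Set.compl_empty,
      measure_univ] at h
    exact one_ne_zero h
  set ν := fun s => G.ν (Fpot f₀ f s)
  set lam := fun s => Real.exp (G.P (Fpot f₀ f s))
  have hφ := G.φ_holder _ (hF t)
  have hφpos := G.φ_pos _ (hF t)
  set φ := restrictSFT A (G.φ (Fpot f₀ f t)) hφ.1
  have hφ0 : ∀ x, 0 < φ x := fun x => hφpos x.1 x.2
  set ψ : C(SFT A, ℝ) := ⟨fun x => (φ x)⁻¹, φ.continuous.inv₀ fun x => (hφ0 x).ne'⟩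
  have hψ0 : ∀ x, 0 < ψ x := fun x => inv_pos.2 (hφ0 x)
  have hψφ : ψ * φ = 1 := ContinuousMap.ext fun x => inv_mul_cancel₀ (hφ0 x).ne'
  set E := fun s => expWeight A (Fpot f₀ f s) (hF s).1
  obtain ⟨c₀, B, ρ₁, hc₀, hc₀φ, hB, hρ₁, hρ₁1, hφlip⟩ := hφ.exists_le_exp_mul hφpos
  obtain ⟨C, ρ₂, hC, hρ₂, hρ₂1, hFlip⟩ := (hF t).exists_bound
  set ρ := max ρ₁ ρ₂
  have hρ : 0 < ρ := lt_max_of_lt_left hρ₁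
  have hρ1 : ρ < 1 := max_lt hρ₁1 hρ₂1
  have hφ' : ∀ n x y, Agree n x y → φ x ≤ Real.exp (B * ρ ^ n) * φ y :=
    hφlip ρ (le_max_left _ _)
  have hψ' : ∀ n x y, Agree n x y → ψ x ≤ Real.exp (B * ρ ^ n) * ψ y := by
    intro n x y hxy
    have h := hφ' n y x hxy.symm
    change (φ x)⁻¹ ≤ Real.exp (B * ρ ^ n) * (φ y)⁻¹
    rw [← div_eq_mul_inv, le_div_iff₀ (hφ0 y), inv_mul_le_iff₀ (hφ0 x), mul_comm]
    exact h
  have hE' : ∀ n x y, Agree n x y → E t x ≤ Real.exp (C * ρ ^ n) * E t y := by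
    intro n x y hxy
    have h := (abs_le.1 (hFlip ρ (le_max_right _ _) n x.1 y.1 hxy)).2
    simp only [E, expWeight_apply]
    rw [← Real.exp_add, Real.exp_le_exp]
    linarith
  have heigφ : sumPre A (E t * φ) = lam t • φ := by
    ext x
    rw [← sumPre_expWeight_mul (hF t).1 (g := G.φ (Fpot f₀ f t)) (fun _ => rfl)]
    exact G.φ_eigen _ (hF t) x.1 x.2
  have hp := normalizedWeight_of_eigenfunction (Real.exp_pos _) hC hB hρ hρ1
    (fun x => Real.exp_pos _) hφ0 hψ0 hψφ heigφ hE' hφ' hψ'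
  set p := ((lam t)⁻¹ • ψ).comp shiftX * (E t * φ) with hpdef
  set fX := fun j => restrictSFT A (f j) (hf j).1
  set m : (Fin d → ℝ) → C(SFT A, ℝ) →L[ℝ] ℝ := fun s =>
    (integralSFT A (ν s)).comp (ContinuousLinearMap.mul ℝ _ φ)
  have hm : ∀ s g, m s g = integralSFT A (ν s) (φ * g) := fun _ _ => rfl
  have heig : ∀ s g, m s (ruelle p (expPert fX t s * g)) = lam s / lam t * m s g := by
    intro s g
    have h1 : ruelle p (expPert fX t s * g) = (lam t)⁻¹ • (ψ * sumPre A (E s * (φ * g))) := by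
      rw [ruelle_eq, hpdef, mul_assoc, sumPre_comp_shiftX_mul, smul_mul_assoc,
        ← show E t * expPert fX t s = E s from
          expWeight_mul_expPert (fun j => (hf j).1) t s (hF t).1 (hF s).1]
      congr 3
      ring
    rw [hm, h1, mul_smul_comm, ← mul_assoc, mul_comm φ, hψφ, one_mul, map_smul,
      (G.eigen _ (hF s)).integralSFT_sumPre, hm, smul_eq_mul]
    ring
  have hψosc : ∀ n x y, Agree n x y → |ψ x - ψ y| ≤ Real.exp B * B * ‖ψ‖ * ρ ^ n := by
    intro n x y hxy
    have h := abs_sub_le_of_le_exp_mul (mul_nonneg hB (pow_nonneg hρ.le n))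
      (mul_le_of_le_one_right hB (pow_le_one₀ hρ.le hρ1.le)) (hψ0 y).le (hψ' n x y hxy)
      (hψ' n y x hxy.symm)
    calc _ ≤ _ := h
      _ ≤ Real.exp B * (B * ρ ^ n) * ‖ψ‖ := by
        gcongr
        exact (le_abs_self _).trans (ψ.norm_coe_le_norm y)
      _ = _ := by ring
  have honet : m t 1 = 1 := by
    rw [hm, mul_one, integralSFT_eq (hsupp t) φ (fun _ => rfl)]
    exact G.φ_norm _ (hF t)
  obtain ⟨K, hK⟩ := hp.exists_abs_fderiv_log_sub_le hmix (f := fX) (t := t) (m := m)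
    (κ := fun s => lam s / lam t) (C := ‖φ‖) (c := c₀) heig
    (fun s => ContinuousLinearMap.opNorm_le_bound _ (norm_nonneg _) fun g =>
      (abs_integralSFT_le _).trans (norm_mul_le _ _)) hc₀
    (fun s => by
      have h := integralSFT_nonneg (ν s) (g := φ - c₀ • 1) fun x => by
        simpa using show c₀ ≤ φ x from hc₀φ x
      rw [map_sub, map_smul, integralSFT_one (hsupp s), smul_eq_mul, mul_one, sub_nonneg] at h
      rwa [hm, mul_one])
    (ψ := ψ) (fun s => by rw [hm, mul_comm, hψφ, integralSFT_one (hsupp s)])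
    (O := Real.exp B * B * ‖ψ‖) (V := Real.exp B * B * ‖ψ‖) (B₁ := B)
    ⟨fun x y => by simpa using hψosc 0 x y fun k hk => absurd hk k.not_lt_zero,
      fun n x y => hψosc (n + 1) x y⟩
    ⟨fun x => (hψ0 x).le, fun n x y => hψ' (n + 1) x y⟩
    (fun g hg => integralSFT_nonneg _ (mul_nonneg (fun x => (hφ0 x).le) hg)) honet
    (fun g => by
      have h := heig t g
      rwa [expPert_self, one_mul, div_self (Real.exp_pos _).ne', one_mul] at h) i
  have hmul : ∀ s b n (c : ℕ → Fin a),
      m s (b * (cylIndicator A n c * ψ)) = integralSFT A (ν s) (b * cylIndicator A n c) := by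
    intro s b n c
    rw [hm, show φ * (b * (cylIndicator A n c * ψ)) = ψ * φ * (b * cylIndicator A n c) by ring,
      hψφ, one_mul]
  have hcyl : ∀ s n (c : ℕ → Fin a), m s (cylIndicator A n c * ψ) = (ν s (cyl A n c)).toReal := by
    intro s n c
    have h := hmul s 1 n c
    rwa [one_mul, one_mul, integralSFT_cylIndicator (hsupp s)] at h
  have hmean : ∫ z, f i z ∂(G.μ (Fpot f₀ f t)) = m t (fX i) := G.integral_μ (hF t) _ (hf i).1
  refine ⟨K, fun n _ c hcpos => ?_⟩
  have hbirk : m t ((∑ k ∈ Finset.range n, koopman^[k] (fX i - m t (fX i) • 1)) *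
      (cylIndicator A n c * ψ)) = ∫ x in cyl A n c,
        birkhoff n (fun y => f i y - ∫ z, f i z ∂(G.μ (Fpot f₀ f t))) x ∂(ν t) := by
    rw [hmul]
    refine integralSFT_mul_cylIndicator (hsupp t) n c _ fun x => ?_
    rw [birkhoff, ContinuousMap.sum_apply]
    refine Finset.sum_congr rfl fun k _ => ?_
    rw [koopman_iterate_apply, hmean, ContinuousMap.sub_apply, ContinuousMap.smul_apply,
      ContinuousMap.one_apply, smul_eq_mul, mul_one, restrictSFT_apply, iterate_shiftX_val]
  have h := hK n c (by
    rw [hcyl]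
    exact (ENNReal.toReal_pos hcpos (measure_ne_top _ _)).ne')
  rw [hbirk] at h
  simpa only [hcyl] using h

end GibbsPaper
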